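/- arXiv:2412.11977 — 2 statements merged into one kernel-verified Lean document; each statement's English description precedes it below -/
import Mathlib

section
/- Let f be an even-chance SDS on weak preference profiles (m ≥ 3, n ≥ 2) that is weakly strategyproof and ex post efficient, and suppose I and J are decisive coalitions with 1 < |I| = |J| < n and |I ∖ J| = |J ∖ I| = 1. Then I ∩ J is also decisive for f. -/
open Classical Finset

/-- A weak preference relation: complete and transitive. -/
structure WeakPref (A : Type*) where
  rel : A → A → Prop
  total : ∀ a b, rel a b ∨ rel b a
  trans : ∀ {a b c}, rel a b → rel b c → rel a c

variable {A V : Type*} [Fintype A] [Fintype V]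

/-- Probability of the upper contour set of `x` under the uniform lottery over `X`. -/
noncomputable def setProb (X : Finset A) (r : A → A → Prop) (x : A) : ℝ :=
  ((X.filter (fun y => r y x)).card : ℝ) / (X.card : ℝ)

/-- The uniform lottery over `X` (weakly) stochastically dominates the one over `Y`. -/
def SDset (r : A → A → Prop) (X Y : Finset A) : Prop :=
  ∀ x, setProb Y r x ≤ setProb X r x

def StrictSDset (r : A → A → Prop) (X Y : Finset A) : Prop :=
  SDset r X Y ∧ ∃ x, setProb Y r x < setProb X r x

/-- The set of most preferred alternatives of the weak order `r`. -/
noncomputable def tops (r : A → A → Prop) : Finset A :=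
  Finset.univ.filter (fun x => ∀ y, r x y)

/-- Weak strategyproofness of an even-chance SDS (viewed as a set-valued rule). -/
def WeakSPset (f : (V → WeakPref A) → Finset A) : Prop :=
  ∀ R R' : V → WeakPref A, ∀ i : V,
    (∀ j, j ≠ i → R j = R' j) → ¬ StrictSDset (R i).rel (f R') (f R)

/-- Ex post efficiency: no Pareto-dominated alternative is ever chosen. -/
def ExPostEffSet (f : (V → WeakPref A) → Finset A) : Prop :=
  ∀ (R : V → WeakPref A) (y : A),
    (∃ x, (∀ i, (R i).rel x y) ∧ (∃ i, ¬ (R i).rel y x)) → y ∉ f R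

/-- A coalition `G` is decisive: whenever all its members report the same preference
relation, the choice set is a subset of their common top alternatives. -/
def Decisive (f : (V → WeakPref A) → Finset A) (G : Finset V) : Prop :=
  ∀ R : V → WeakPref A, (∀ i ∈ G, ∀ j ∈ G, R i = R j) →
    ∀ i ∈ G, f R ⊆ tops (R i).rel

/-- A coalition `G` is nominating: whenever all its members report the same preference
relation, the choice set intersects their common top alternatives. -/
def Nominating (f : (V → WeakPref A) → Finset A) (G : Finset V) : Prop :=
  ∀ R : V → WeakPref A, (∀ i ∈ G, ∀ j ∈ G, R i = R j) →
    ∀ i ∈ G, (f R ∩ tops (R i).rel).Nonempty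

/-- The uniform lottery over `X` strictly dominates the one over `Y` for a voter who ranks the
three alternatives by `p`, smaller ranks being better. -/
def RankDom (p : Fin 3 → Fin 3) (X Y : Finset (Fin 3)) : Prop :=
  (∀ x, (Y.filter fun y => p y ≤ p x).card * X.card ≤
      (X.filter fun y => p y ≤ p x).card * Y.card) ∧
    ∃ x, (Y.filter fun y => p y ≤ p x).card * X.card <
      (X.filter fun y => p y ≤ p x).card * Y.card

instance (p : Fin 3 → Fin 3) (X Y : Finset (Fin 3)) : Decidable (RankDom p X Y) :=
  inferInstanceAs (Decidable (_ ∧ _))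

/-- `X` is a nonempty set without alternatives that are Pareto-dominated in a profile where the
members of a coalition report `p` or `p'`, two further voters report `q` and `r`, and everyone else
is indifferent between the alternatives `1` and `2` and prefers both to `0`. -/
def Undominated (p p' q r : Fin 3 → Fin 3) (X : Finset (Fin 3)) : Prop :=
  X.Nonempty ∧ ∀ y ∈ X, ∀ x, p x ≤ p y → p' x ≤ p' y → q x ≤ q y → r x ≤ r y →
    (![1, 0, 0] : Fin 3 → Fin 3) x ≤ (![1, 0, 0] : Fin 3 → Fin 3) y →
    ¬ ((p x < p y ∧ p' x < p' y) ∨ q x < q y ∨ r x < r y)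

instance (p p' q r : Fin 3 → Fin 3) (X : Finset (Fin 3)) : Decidable (Undominated p p' q r X) :=
  inferInstanceAs (Decidable (_ ∧ _))

/-- The choice set `G p q r` as a function of the common report `p` of a coalition and the reports
`q` and `r` of two voters, each of whom is decisive together with the coalition. -/
structure ContractionRule (G : (Fin 3 → Fin 3) → (Fin 3 → Fin 3) → (Fin 3 → Fin 3) →
    Finset (Fin 3)) : Prop where
  undominated : ∀ p q r, Undominated p p q r (G p q r)
  not_dom_left : ∀ p q r q', ¬ RankDom q (G p q' r) (G p q r)
  not_dom_right : ∀ p q r r', ¬ RankDom r (G p q r') (G p q r)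
  decisive_left : ∀ p r, ∀ x ∈ G p p r, ∀ y, p x ≤ p y
  decisive_right : ∀ p q, ∀ x ∈ G p q p, ∀ y, p x ≤ p y
  move : ∀ (p p' q r : Fin 3 → Fin 3) (Inv : Finset (Fin 3) → Prop),
    (∀ X Y, Undominated p p' q r X → Undominated p p' q r Y → ¬ RankDom p Y X →
      ¬ RankDom p' X Y → Inv X → Inv Y) → Inv (G p q r) → Inv (G p' q r)

namespace ContractionRule

variable {G : (Fin 3 → Fin 3) → (Fin 3 → Fin 3) → (Fin 3 → Fin 3) → Finset (Fin 3)}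

theorem ne_univ (h : ContractionRule G) : G ![0, 1, 1] ![1, 0, 0] ![1, 0, 0] ≠ {0, 1, 2} := by
  intro hW
  have h1 : G ![0, 1, 2] ![1, 0, 0] ![1, 0, 0] = {1} := by
    refine (by decide : ∀ X : Finset (Fin 3),
      Undominated ![0, 1, 2] ![0, 1, 2] ![1, 0, 0] ![1, 0, 0] X →
      (0 ∈ X → X = {0, 1, 2}) → X = {1}) _ (h.undominated _ _ _) ?_
    exact h.move ![0, 1, 1] ![0, 1, 2] _ _ (fun X => 0 ∈ X → X = {0, 1, 2}) (by decide)
      (fun _ => hW)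
  have h2 : G ![0, 1, 1] ![1, 0, 1] ![1, 0, 0] = {0, 1} :=
    (by decide : ∀ X : Finset (Fin 3), Undominated ![0, 1, 1] ![0, 1, 1] ![1, 0, 1] ![1, 0, 0] X →
      ¬ RankDom ![1, 0, 0] X {0, 1, 2} → ¬ RankDom ![1, 0, 1] {0, 1, 2} X → X = {0, 1}) _
      (h.undominated _ _ _) (hW ▸ h.not_dom_left _ ![1, 0, 0] _ _)
      (hW ▸ h.not_dom_left _ ![1, 0, 1] _ ![1, 0, 0])
  have h3 : G ![0, 1, 2] ![1, 0, 1] ![1, 0, 0] = {1} :=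
    (by decide : ∀ X : Finset (Fin 3), Undominated ![0, 1, 2] ![0, 1, 2] ![1, 0, 1] ![1, 0, 0] X →
      ¬ RankDom ![1, 0, 1] {1} X → X = {1}) _ (h.undominated _ _ _)
      (h1 ▸ h.not_dom_left _ ![1, 0, 1] _ ![1, 0, 0])
  have h4 := h.move ![0, 1, 1] ![0, 1, 2] ![1, 0, 1] ![1, 0, 0] (fun X => 0 ∈ X) (by decide)
    (by rw [h2]; decide)
  rw [h3] at h4
  exact absurd h4 (by decide)

theorem ne_pair (h : ContractionRule G) : G ![0, 1, 1] ![1, 0, 0] ![1, 0, 0] ≠ {0, 1} := by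
  intro hW
  have h1 : G ![0, 1, 1] ![1, 0, 2] ![1, 0, 0] = {0, 1} :=
    (by decide : ∀ X : Finset (Fin 3), Undominated ![0, 1, 1] ![0, 1, 1] ![1, 0, 2] ![1, 0, 0] X →
      ¬ RankDom ![1, 0, 0] X {0, 1} → ¬ RankDom ![1, 0, 2] {0, 1} X → X = {0, 1}) _
      (h.undominated _ _ _) (hW ▸ h.not_dom_left _ ![1, 0, 0] _ _)
      (hW ▸ h.not_dom_left _ ![1, 0, 2] _ ![1, 0, 0])
  have h2 : G ![0, 1, 1] ![2, 0, 1] ![1, 0, 0] = {0, 1} :=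
    (by decide : ∀ X : Finset (Fin 3), Undominated ![0, 1, 1] ![0, 1, 1] ![2, 0, 1] ![1, 0, 0] X →
      ¬ RankDom ![1, 0, 0] X {0, 1} → ¬ RankDom ![2, 0, 1] {0, 1} X → X = {0, 1}) _
      (h.undominated _ _ _) (hW ▸ h.not_dom_left _ ![1, 0, 0] _ _)
      (hW ▸ h.not_dom_left _ ![2, 0, 1] _ ![1, 0, 0])
  have h3 : G ![0, 1, 1] ![2, 1, 0] ![1, 0, 0] = {0, 2} :=
    (by decide : ∀ X : Finset (Fin 3), Undominated ![0, 1, 1] ![0, 1, 1] ![2, 1, 0] ![1, 0, 0] X →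
      ¬ RankDom ![1, 0, 0] X {0, 1} → ¬ RankDom ![2, 1, 0] {0, 1} X → X = {0, 2}) _
      (h.undominated _ _ _) (hW ▸ h.not_dom_left _ ![1, 0, 0] _ _)
      (hW ▸ h.not_dom_left _ ![2, 1, 0] _ ![1, 0, 0])
  have h4 : G ![0, 1, 1] ![1, 0, 2] ![2, 1, 0] = {0, 1} :=
    (by decide : ∀ X Y : Finset (Fin 3), X.Nonempty →
      (∀ x ∈ Y, ∀ y, (![0, 1, 1] : Fin 3 → Fin 3) x ≤ (![0, 1, 1] : Fin 3 → Fin 3) y) →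
      Y.Nonempty → ¬ RankDom ![1, 0, 2] Y X → ¬ RankDom ![1, 0, 0] X {0, 1} →
      ¬ RankDom ![2, 1, 0] {0, 1} X → X = {0, 1}) _ _ (h.undominated _ _ _).1
      (h.decisive_left _ _) (h.undominated _ _ _).1 (h.not_dom_left _ _ _ ![0, 1, 1])
      (h1 ▸ h.not_dom_right _ _ ![1, 0, 0] _) (h1 ▸ h.not_dom_right _ _ ![2, 1, 0] ![1, 0, 0])
  have h5 : G ![0, 1, 1] ![2, 0, 1] ![2, 1, 0] = {0, 1} :=
    (by decide : ∀ X : Finset (Fin 3), X.Nonempty → ¬ RankDom ![1, 0, 0] X {0, 1} →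
      ¬ RankDom ![2, 1, 0] {0, 1} X → ¬ RankDom ![2, 0, 1] {0, 1} X → X = {0, 1}) _
      (h.undominated _ _ _).1 (h2 ▸ h.not_dom_right _ _ ![1, 0, 0] _)
      (h2 ▸ h.not_dom_right _ _ ![2, 1, 0] ![1, 0, 0])
      (h4 ▸ h.not_dom_left _ ![2, 0, 1] _ ![1, 0, 2])
  have h6 : G ![0, 1, 1] ![2, 1, 0] ![1, 2, 0] = {0, 2} :=
    (by decide : ∀ X : Finset (Fin 3), Undominated ![0, 1, 1] ![0, 1, 1] ![2, 1, 0] ![1, 2, 0] X →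
      ¬ RankDom ![1, 0, 0] X {0, 2} → ¬ RankDom ![1, 2, 0] {0, 2} X → X = {0, 2}) _
      (h.undominated _ _ _) (h3 ▸ h.not_dom_right _ _ ![1, 0, 0] _)
      (h3 ▸ h.not_dom_right _ _ ![1, 2, 0] ![1, 0, 0])
  have h7 : RankDom ![2, 0, 1] {0, 2} (G ![0, 1, 1] ![2, 0, 1] ![1, 2, 0]) :=
    (by decide : ∀ X Y : Finset (Fin 3), X.Nonempty →
      (∀ x ∈ Y, ∀ y, (![0, 1, 1] : Fin 3 → Fin 3) x ≤ (![0, 1, 1] : Fin 3 → Fin 3) y) →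
      Y.Nonempty → ¬ RankDom ![1, 2, 0] Y X → ¬ RankDom ![1, 0, 0] X {0, 1} →
      ¬ RankDom ![2, 1, 0] X {0, 1} → RankDom ![2, 0, 1] {0, 2} X) _ _ (h.undominated _ _ _).1
      (h.decisive_right _ _) (h.undominated _ _ _).1 (h.not_dom_right _ _ _ ![0, 1, 1])
      (h2 ▸ h.not_dom_right _ _ ![1, 0, 0] _) (h5 ▸ h.not_dom_right _ _ ![2, 1, 0] _)
  rw [← h6] at h7
  exact h.not_dom_left _ _ _ _ h7

theorem zero_mem_or_two_notMem (h : ContractionRule G) :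
    0 ∈ G ![0, 1, 1] ![1, 0, 0] ![1, 0, 0] ∨ 2 ∉ G ![0, 1, 1] ![1, 0, 0] ![1, 0, 0] := by
  by_contra! hW
  obtain ⟨hW0, hW2⟩ := hW
  have h1 : G ![0, 1, 1] ![1, 0, 0] ![2, 1, 0] = {2} :=
    (by decide : ∀ X W : Finset (Fin 3), Undominated ![0, 1, 1] ![0, 1, 1] ![1, 0, 0] ![2, 1, 0] X →
      0 ∉ W → 2 ∈ W → ¬ RankDom ![2, 1, 0] W X → X = {2}) _ _
      (h.undominated _ _ _) hW0 hW2 (h.not_dom_right _ _ _ _)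
  have h2 : G ![0, 1, 1] ![1, 0, 0] ![1, 2, 0] = {2} :=
    (by decide : ∀ X : Finset (Fin 3), X.Nonempty → ¬ RankDom ![1, 2, 0] {2} X → X = {2}) _
      (h.undominated _ _ _).1 (h1 ▸ h.not_dom_right _ _ ![1, 2, 0] ![2, 1, 0])
  have h3 : G ![0, 0, 1] ![0, 0, 1] ![2, 1, 0] = {1} :=
    (by decide : ∀ X : Finset (Fin 3), Undominated ![0, 0, 1] ![0, 0, 1] ![0, 0, 1] ![2, 1, 0] X →
      (∀ x ∈ X, ∀ y, (![0, 0, 1] : Fin 3 → Fin 3) x ≤ (![0, 0, 1] : Fin 3 → Fin 3) y) →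
      X = {1}) _ (h.undominated _ _ _) (h.decisive_left _ _)
  have h4 : G ![0, 0, 1] ![2, 0, 1] ![2, 1, 0] = {1} :=
    (by decide : ∀ X : Finset (Fin 3), X.Nonempty → ¬ RankDom ![2, 0, 1] {1} X → X = {1}) _
      (h.undominated _ _ _).1 (h3 ▸ h.not_dom_left _ ![2, 0, 1] _ ![0, 0, 1])
  have h5 : G ![0, 0, 1] ![2, 0, 1] ![1, 1, 0] = {1} :=
    (by decide : ∀ X : Finset (Fin 3), Undominated ![0, 0, 1] ![0, 0, 1] ![2, 0, 1] ![1, 1, 0] X →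
      ¬ RankDom ![2, 1, 0] X {1} → X = {1}) _ (h.undominated _ _ _)
      (h4 ▸ h.not_dom_right _ _ ![2, 1, 0] _)
  have h6 (r) : 2 ∉ G ![0, 0, 1] ![2, 0, 1] r :=
    (by decide : ∀ X : Finset (Fin 3), ¬ RankDom ![1, 1, 0] X {1} → 2 ∉ X) _
      (h5 ▸ h.not_dom_right _ _ ![1, 1, 0] _)
  have h7 (r) : 0 ∈ G ![0, 1, 2] ![2, 0, 1] r ∨ G ![0, 1, 2] ![2, 0, 1] r = {1} :=
    h.move ![0, 0, 1] ![0, 1, 2] _ _ (fun X => 0 ∈ X ∨ X = {1})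
      (fun X Y hX hY _ hd hi => (by decide : ∀ X Y : Finset (Fin 3), X.Nonempty → Y.Nonempty →
        ¬ RankDom ![0, 1, 2] X Y → 0 ∈ X ∨ X = {1} → 0 ∈ Y ∨ Y = {1}) X Y hX.1 hY.1 hd hi)
      ((by decide : ∀ X : Finset (Fin 3), X.Nonempty → 2 ∉ X → 0 ∈ X ∨ X = {1}) _
        (h.undominated _ _ _).1 (h6 r))
  have h8 : 0 ∈ G ![0, 1, 2] ![2, 0, 1] ![1, 2, 0] :=
    (by decide : ∀ X Y : Finset (Fin 3), Y.Nonempty →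
      (∀ x ∈ Y, ∀ y, (![0, 1, 2] : Fin 3 → Fin 3) x ≤ (![0, 1, 2] : Fin 3 → Fin 3) y) →
      ¬ RankDom ![1, 2, 0] Y X → 0 ∈ X ∨ X = {1} → 0 ∈ X) _ _ (h.undominated _ _ _).1
      (h.decisive_right _ _) (h.not_dom_right _ _ _ _) (h7 _)
  have h9 : 0 ∈ G ![0, 1, 2] ![2, 0, 1] ![0, 1, 0] ∧ 1 ∉ G ![0, 1, 2] ![2, 0, 1] ![0, 1, 0] :=
    (by decide : ∀ X Y : Finset (Fin 3), Y.Nonempty →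
      (∀ x ∈ Y, ∀ y, (![0, 1, 2] : Fin 3 → Fin 3) x ≤ (![0, 1, 2] : Fin 3 → Fin 3) y) →
      ¬ RankDom ![0, 1, 0] Y X → 0 ∈ X ∨ X = {1} → 0 ∈ X ∧ 1 ∉ X) _ _ (h.undominated _ _ _).1
      (h.decisive_right _ _) (h.not_dom_right _ _ _ _) (h7 _)
  have h10 : 0 ∈ G ![0, 1, 1] ![2, 0, 1] ![1, 2, 0] :=
    h.move ![0, 1, 2] ![0, 1, 1] _ _ (fun X => 0 ∈ X)
      (fun X Y _ hY _ hd hi => (by decide : ∀ X Y : Finset (Fin 3), Y.Nonempty →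
        ¬ RankDom ![0, 1, 1] X Y → 0 ∈ X → 0 ∈ Y) X Y hY.1 hd hi) h8
  have h11 : G ![0, 1, 1] ![2, 0, 1] ![1, 2, 0] = {0, 1, 2} :=
    (by decide : ∀ X Y : Finset (Fin 3), Y.Nonempty →
      (∀ x ∈ Y, ∀ y, (![0, 1, 1] : Fin 3 → Fin 3) x ≤ (![0, 1, 1] : Fin 3 → Fin 3) y) →
      ¬ RankDom ![1, 2, 0] Y X → 0 ∈ X → ¬ RankDom ![2, 0, 1] {2} X → X = {0, 1, 2}) _ _
      (h.undominated _ _ _).1 (h.decisive_right _ _) (h.not_dom_right _ _ _ _) h10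
      (h2 ▸ h.not_dom_left _ ![2, 0, 1] _ ![1, 0, 0])
  have h12 : 0 ∉ G ![0, 1, 2] ![1, 0, 0] ![1, 2, 0] :=
    h.move ![0, 1, 1] ![0, 1, 2] _ _ (fun X => 0 ∉ X)
      (fun X Y hX _ hd _ hi => (by decide : ∀ X Y : Finset (Fin 3), X.Nonempty →
        ¬ RankDom ![0, 1, 1] Y X → 0 ∉ X → 0 ∉ Y) X Y hX.1 hd hi) (by rw [h2]; decide)
  have h13 : G ![0, 1, 2] ![1, 0, 0] ![1, 2, 0] = {2} := by
    have h14 : 2 ∈ G ![0, 1, 2] ![1, 0, 0] ![1, 2, 0] :=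
      (by decide : ∀ X Y : Finset (Fin 3), X.Nonempty → Y.Nonempty →
        (∀ x ∈ Y, ∀ y, (![0, 1, 2] : Fin 3 → Fin 3) x ≤ (![0, 1, 2] : Fin 3 → Fin 3) y) →
        ¬ RankDom ![1, 2, 0] Y X → 0 ∉ X → 2 ∈ X) _ _ (h.undominated _ _ _).1
        (h.undominated _ _ _).1 (h.decisive_right _ _) (h.not_dom_right _ _ _ _) h12
    exact (by decide : ∀ X Y : Finset (Fin 3), 0 ∉ X → 2 ∈ X → 0 ∈ Y →
      ¬ RankDom ![2, 0, 1] X Y → X = {2}) _ _ h12 h14 h8 (h.not_dom_left _ _ _ _)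
  have h15 : G ![0, 0, 1] ![1, 0, 0] ![1, 2, 0] = {2} :=
    h.move ![0, 1, 2] ![0, 0, 1] _ _ (fun X => X = {2})
      (fun X Y _ hY hd _ hi => (by decide : ∀ Y : Finset (Fin 3), Y.Nonempty →
        ¬ RankDom ![0, 1, 2] Y {2} → Y = {2}) Y hY.1 (hi ▸ hd)) h13
  have h16 : G ![0, 0, 1] ![2, 0, 1] ![1, 2, 0] = {1} := by
    refine (by decide : ∀ X : Finset (Fin 3), X.Nonempty → 2 ∉ X → ¬ RankDom ![2, 0, 1] {2} X →
      (0 ∈ X → 2 ≤ (X.erase 0).card) → X = {1}) _ (h.undominated _ _ _).1 (h6 _)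
      (h15 ▸ h.not_dom_left _ ![2, 0, 1] _ ![1, 0, 0]) ?_
    exact h.move ![0, 1, 1] ![0, 0, 1] _ _ (fun X => 0 ∈ X → 2 ≤ (X.erase 0).card)
      (fun X Y hX _ hd _ hi => (by decide : ∀ X Y : Finset (Fin 3), X.Nonempty →
        ¬ RankDom ![0, 1, 1] Y X → (0 ∈ X → 2 ≤ (X.erase 0).card) →
        0 ∈ Y → 2 ≤ (Y.erase 0).card) X Y hX.1 hd hi) (by rw [h11]; decide)
  have h17 : G ![0, 0, 1] ![2, 0, 1] ![0, 1, 0] = {1} :=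
    (by decide : ∀ X : Finset (Fin 3), X.Nonempty → 2 ∉ X → ¬ RankDom ![1, 2, 0] X {1} → X = {1}) _
      (h.undominated _ _ _).1 (h6 _) (h16 ▸ h.not_dom_right _ _ ![1, 2, 0] _)
  have h18 : G ![0, 0, 1] ![1, 0, 0] ![0, 1, 0] = {2} :=
    (by decide : ∀ X : Finset (Fin 3), X.Nonempty → ¬ RankDom ![0, 1, 0] {2} X →
      ¬ RankDom ![1, 0, 0] {1} X → X = {2}) _ (h.undominated _ _ _).1
      (h15 ▸ h.not_dom_right _ _ ![0, 1, 0] ![1, 2, 0])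
      (h17 ▸ h.not_dom_left _ ![1, 0, 0] _ ![2, 0, 1])
  have h19 : G ![0, 1, 2] ![1, 0, 0] ![0, 1, 0] = {2} :=
    h.move ![0, 0, 1] ![0, 1, 2] _ _ (fun X => X = {2})
      (fun X Y _ hY hd _ hi => (by decide : ∀ Y : Finset (Fin 3), Y.Nonempty →
        ¬ RankDom ![0, 0, 1] Y {2} → Y = {2}) Y hY.1 (hi ▸ hd)) h18
  exact (by decide : ∀ X : Finset (Fin 3), 0 ∈ X ∧ 1 ∉ X → RankDom ![2, 0, 1] {2} X) _ h9
    |> (h19 ▸ h.not_dom_left _ ![2, 0, 1] _ ![1, 0, 0])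

/-- Not all choices are possible when the coalition ranks `0` first and everyone else last. -/
theorem choice_cases (h : ContractionRule G) :
    G ![0, 1, 1] ![1, 0, 0] ![1, 0, 0] = {0} ∨ G ![0, 1, 1] ![1, 0, 0] ![1, 0, 0] = {1} ∨
      G ![0, 1, 1] ![1, 0, 0] ![1, 0, 0] = {0, 2} :=
  (by decide : ∀ X : Finset (Fin 3), X.Nonempty → X ≠ {0, 1, 2} → X ≠ {0, 1} → 0 ∈ X ∨ 2 ∉ X →
    X = {0} ∨ X = {1} ∨ X = {0, 2}) _ (h.undominated _ _ _).1 h.ne_univ h.ne_pair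
    h.zero_mem_or_two_notMem

end ContractionRule

/-- Moving the voters one at a time from their report in `R` to their report in `R'` transports
every property of profiles that is preserved by the single steps. -/
theorem profile_induction {P : Type*} {R R' : V → P} {Inv : (V → P) → Prop}
    (step : ∀ Q v, R v ≠ R' v → (∀ w, Q w = R w ∨ Q w = R' w) → Q v = R v → Inv Q →
      Inv (Function.update Q v (R' v))) (hR : Inv R) : Inv R' := by
  have key : ∀ s : Finset V, Inv fun w => if w ∈ s then R' w else R w := by
    intro s
    induction s using Finset.induction_on with
    | empty => simpa using hR
    | insert v s hv ih =>
      have heq : (fun w => if w ∈ insert v s then R' w else R w) =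
          Function.update (fun w => if w ∈ s then R' w else R w) v (R' v) := by
        funext w
        by_cases hw : w = v
        · subst hw; simp
        · simp [hw]
      rw [heq]
      by_cases hRv : R v = R' v
      · rwa [← hRv, Function.update_eq_self_iff.2 (by simp [hv])]
      · refine step _ v hRv (fun w => ?_) (by simp [hv]) ih
        by_cases hw : w ∈ s <;> simp [hw]
  simpa using key Finset.univ

/-- A rule on profiles of rankings of three alternatives for which adding either of the voters `i`
and `j` to the coalition `K` makes it decisive induces a `ContractionRule`. -/
theorem contractionRule_of_rule {g : (V → Fin 3 → Fin 3) → Finset (Fin 3)} {K : Finset V} {i j : V}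
    (hK : K.Nonempty) (hi : i ∉ K) (hj : j ∉ K) (hij : i ≠ j) (hne : ∀ R, (g R).Nonempty)
    (hsp : ∀ R v p, ¬ RankDom (R v) (g (Function.update R v p)) (g R))
    (heff : ∀ R x y, (∀ v, R v x ≤ R v y) → (∃ v, R v x < R v y) → y ∉ g R)
    (hI : ∀ R p, (∀ v ∈ insert i K, R v = p) → ∀ x ∈ g R, ∀ y, p x ≤ p y)
    (hJ : ∀ R p, (∀ v ∈ insert j K, R v = p) → ∀ x ∈ g R, ∀ y, p x ≤ p y) :
    ContractionRule fun p q r =>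
      g fun v => if v ∈ K then p else if v = i then q else if v = j then r else ![1, 0, 0] := by
  have hund : ∀ (p p' q r : Fin 3 → Fin 3) (R : V → Fin 3 → Fin 3), (∀ v ∈ K, R v = p ∨ R v = p') →
      R i = q → R j = r → (∀ v, v ∉ K → v ≠ i → v ≠ j → R v = ![1, 0, 0]) →
      Undominated p p' q r (g R) := by
    intro p p' q r R hp hq hr ho
    refine ⟨hne R, fun y hy x hx hx' hxq hxr hxo hlt => heff R x y (fun v => ?_) ?_ hy⟩
    · by_cases hv : v ∈ K
      · rcases hp v hv with h | h <;> rw [h] <;> assumption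
      by_cases hvi : v = i
      · rwa [hvi, hq]
      by_cases hvj : v = j
      · rwa [hvj, hr]
      rwa [ho v hv hvi hvj]
    · obtain ⟨hlt, hlt'⟩ | hlt | hlt := hlt
      · obtain ⟨k, hk⟩ := hK
        refine ⟨k, ?_⟩
        rcases hp k hk with h | h <;> rw [h] <;> assumption
      · exact ⟨i, by rwa [hq]⟩
      · exact ⟨j, by rwa [hr]⟩
  refine ⟨fun p q r => ?_, fun p q r q' => ?_, fun p q r r' => ?_, fun p r => ?_, fun p q => ?_,
    fun p p' q r Inv hstep h0 => ?_⟩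
  · refine hund p p q r _ (fun v hv => by simp [hv]) (by simp [hi]) (by simp [hj, hij.symm]) ?_
    intro v hv hvi hvj
    simp [hv, hvi, hvj]
  · convert hsp (fun v => if v ∈ K then p else if v = i then q else if v = j then r
      else ![1, 0, 0]) i q' using 2
    · simp [hi]
    · congr 1
      funext v
      by_cases hv : v = i
      · subst hv; simp [hi]
      · simp [hv]
  · convert hsp (fun v => if v ∈ K then p else if v = i then q else if v = j then r
      else ![1, 0, 0]) j r' using 2
    · simp [hj, hij.symm]
    · congr 1
      funext v
      by_cases hv : v = j
      · subst hv; simp [hj, hij.symm]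
      · simp [hv]
  · refine hI _ p fun v hv => ?_
    rcases Finset.mem_insert.1 hv with rfl | hv
    · simp
    · simp [hv]
  · refine hJ _ p fun v hv => ?_
    rcases Finset.mem_insert.1 hv with rfl | hv
    · simp [hij.symm]
    · simp [hv]
  · refine profile_induction (Inv := fun R => Inv (g R)) (fun Q v hv hQ hQv hInv => ?_) h0
    have hvK : v ∈ K := by
      by_contra hvK
      exact hv (by simp [hvK])
    have hpv : Q v = p := by simpa [hvK] using hQv
    have hQK : ∀ w ∈ K, Q w = p ∨ Q w = p' := fun w hw => by simpa [hw] using hQ w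
    have hQi : Q i = q := by simpa [hi] using hQ i
    have hQj : Q j = r := by simpa [hj, hij.symm] using hQ j
    have hQo : ∀ w, w ∉ K → w ≠ i → w ≠ j → Q w = ![1, 0, 0] :=
      fun w hw hwi hwj => by simpa [hw, hwi, hwj] using hQ w
    simp only [hvK, if_true]
    have hiv : i ≠ v := fun h => hi (h ▸ hvK)
    have hjv : j ≠ v := fun h => hj (h ▸ hvK)
    refine hstep (g Q) _ (hund p p' q r Q hQK hQi hQj hQo) (hund p p' q r _ (fun w hw => ?_)
      (by simp [hiv, hQi]) (by simp [hjv, hQj]) fun w hw hwi hwj => ?_) ?_ ?_ hInv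
    · by_cases hwv : w = v
      · subst hwv; simp
      · simpa [hwv] using hQK w hw
    · have hwv : w ≠ v := fun h => hw (h ▸ hvK)
      simpa [hwv] using hQo w hw hwi hwj
    · simpa [hpv] using hsp Q v p'
    · simpa [← hpv] using hsp (Function.update Q v p') v p

/-- The weak order in which three alternatives, given by an embedding, are ranked as prescribed,
and all others are indifferent and less preferred. -/
noncomputable def rankPref {B : Type*} (e : Fin 3 ↪ B) (ρ : Fin 3 → Fin 3) : WeakPref B where
  rel x y := Function.extend e (fun t => (ρ t : ℕ)) (fun _ => 3) x ≤
    Function.extend e (fun t => (ρ t : ℕ)) (fun _ => 3) y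
  total _ _ := le_total _ _
  trans := le_trans

namespace rankPref

variable {B : Type*} {e : Fin 3 ↪ B} {ρ : Fin 3 → Fin 3}

@[simp]
theorem rel_apply_apply (s t : Fin 3) : (rankPref e ρ).rel (e s) (e t) ↔ ρ s ≤ ρ t := by
  simp [rankPref, e.injective.extend_apply]

theorem rel_of_notMem_range (t : Fin 3) {x : B} (hx : x ∉ Set.range e) :
    (rankPref e ρ).rel (e t) x := by
  have := (ρ t).isLt
  simp only [rankPref, e.injective.extend_apply, Function.extend_apply' _ _ _ hx]
  omega

theorem not_rel_of_notMem_range (t : Fin 3) {x : B} (hx : x ∉ Set.range e) :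
    ¬ (rankPref e ρ).rel x (e t) := by
  have := (ρ t).isLt
  simp only [rankPref, e.injective.extend_apply, Function.extend_apply' _ _ _ hx]
  omega

theorem comp_perm (σ : Equiv.Perm (Fin 3)) :
    rankPref (σ.toEmbedding.trans e) (ρ ∘ σ) = rankPref e ρ := by
  have h : Function.extend (σ.toEmbedding.trans e) (fun t => ((ρ ∘ σ) t : ℕ)) (fun _ => 3) =
      Function.extend e (fun t => (ρ t : ℕ)) (fun _ => 3) := by
    funext x
    by_cases hx : x ∈ Set.range e
    · obtain ⟨t, rfl⟩ := hx
      obtain ⟨s, rfl⟩ := σ.surjective t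
      rw [e.injective.extend_apply]
      exact (σ.toEmbedding.trans e).injective.extend_apply (fun t => ((ρ ∘ σ) t : ℕ)) _ s
    · rw [Function.extend_apply' _ _ _ hx, Function.extend_apply']
      rintro ⟨s, rfl⟩
      exact hx ⟨σ s, rfl⟩
  simp only [rankPref, h]

theorem setProb_map_apply (X : Finset (Fin 3)) (t : Fin 3) :
    setProb (X.map e) (rankPref e ρ).rel (e t) =
      ((X.filter fun s => ρ s ≤ ρ t).card : ℝ) / X.card := by
  rw [setProb, Finset.filter_map, Finset.card_map, Finset.card_map]
  simp

theorem setProb_map_of_notMem_range {X : Finset (Fin 3)} (hX : X.Nonempty) {x : B}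
    (hx : x ∉ Set.range e) : setProb (X.map e) (rankPref e ρ).rel x = 1 := by
  rw [setProb, Finset.filter_true_of_mem, div_self]
  · simpa using hX.ne_empty
  · simp [rel_of_notMem_range _ hx]

theorem strictSDset_map {X Y : Finset (Fin 3)} (hX : X.Nonempty) (hY : Y.Nonempty)
    (h : RankDom ρ X Y) : StrictSDset (rankPref e ρ).rel (X.map e) (Y.map e) := by
  have hX' : (0 : ℝ) < X.card := by exact_mod_cast hX.card_pos
  have hY' : (0 : ℝ) < Y.card := by exact_mod_cast hY.card_pos
  obtain ⟨hle, t, hlt⟩ := h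
  refine ⟨fun x => ?_, e t, ?_⟩
  · by_cases hx : x ∈ Set.range e
    · obtain ⟨t, rfl⟩ := hx
      rw [setProb_map_apply, setProb_map_apply, div_le_div_iff₀ hY' hX']
      exact_mod_cast hle t
    · rw [setProb_map_of_notMem_range hX hx, setProb_map_of_notMem_range hY hx]
  · rw [setProb_map_apply, setProb_map_apply, div_lt_div_iff₀ hY' hX']
    exact_mod_cast hlt

end rankPref

theorem setProb_le_one {B : Type*} (X : Finset B) (r : B → B → Prop) (x : B) :
    setProb X r x ≤ 1 :=
  div_le_one_of_le₀ (by exact_mod_cast Finset.card_filter_le _ _) (Nat.cast_nonneg _)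

theorem setProb_eq_one {B : Type*} {X : Finset B} {r : B → B → Prop} {x : B} (hX : X.Nonempty)
    (h : ∀ y ∈ X, r y x) : setProb X r x = 1 := by
  rw [setProb, Finset.filter_true_of_mem h, div_self]
  simpa using hX.ne_empty

theorem mem_tops {r : A → A → Prop} {x : A} : x ∈ tops r ↔ ∀ y, r x y := by simp [tops]

/-- A lottery over top alternatives strictly dominates every lottery that is not. -/
theorem strictSDset_of_subset_tops (P : WeakPref A) {X Y : Finset A} (hX : X.Nonempty)
    (hXt : X ⊆ tops P.rel) (hY : ¬ Y ⊆ tops P.rel) : StrictSDset P.rel X Y := by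
  have h1 : ∀ x, setProb X P.rel x = 1 := fun x =>
    setProb_eq_one hX fun y hy => mem_tops.1 (hXt hy) x
  refine ⟨fun x => (setProb_le_one _ _ _).trans (h1 x).ge, ?_⟩
  obtain ⟨x, hx⟩ := hX
  obtain ⟨y, hy, hyt⟩ := Finset.not_subset.1 hY
  refine ⟨x, (h1 x).symm ▸ ?_⟩
  have hYpos : (0 : ℝ) < Y.card := by exact_mod_cast Finset.card_pos.2 ⟨y, hy⟩
  rw [setProb, div_lt_one hYpos]
  refine Nat.cast_lt.2 (Finset.card_lt_card (Finset.filter_ssubset.2 ⟨y, hy, fun hyx => ?_⟩))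
  exact hyt (mem_tops.2 fun z => P.trans hyx (mem_tops.1 (hXt hx) z))

theorem tops_nonempty [Nonempty A] (P : WeakPref A) : (tops P.rel).Nonempty := by
  have key : ∀ s : Finset A, s.Nonempty → ∃ x ∈ s, ∀ y ∈ s, P.rel x y := by
    intro s hs
    induction hs using Finset.Nonempty.cons_induction with
    | singleton a => simpa using (P.total a a).elim id id
    | cons a s ha hs ih =>
      obtain ⟨x, hx, hxs⟩ := ih
      rcases P.total a x with h | h
      · refine ⟨a, by simp, fun y hy => ?_⟩
        rcases Finset.mem_cons.1 hy with rfl | hy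
        · exact (P.total y y).elim id id
        · exact P.trans h (hxs y hy)
      · refine ⟨x, by simp [hx], fun y hy => ?_⟩
        rcases Finset.mem_cons.1 hy with rfl | hy
        · exact h
        · exact hxs y hy
  obtain ⟨x, -, hx⟩ := key Finset.univ Finset.univ_nonempty
  exact ⟨x, mem_tops.2 fun y => hx y (Finset.mem_univ y)⟩

/-- The weak order in which `a` is the unique least preferred alternative and all others are
indifferent. -/
def bottomPref {B : Type*} (a : B) : WeakPref B where
  rel x y := y = a ∨ x ≠ a
  total x y := by tauto
  trans := by rintro x y z (rfl | h) (rfl | h') <;> tauto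

theorem strictSDset_bottomPref {B : Type*} {a : B} {X : Finset B} (hX : X.Nonempty)
    (hXa : X ≠ {a}) : StrictSDset (bottomPref a).rel X {a} := by
  have h1 : setProb X (bottomPref a).rel a = 1 := setProb_eq_one hX fun y _ => Or.inl rfl
  have h0 : ∀ x, x ≠ a → setProb {a} (bottomPref a).rel x = 0 := by
    intro x hx
    simp [setProb, bottomPref, Finset.filter_singleton, hx]
  obtain ⟨x, hx, hxa⟩ : ∃ x ∈ X, x ≠ a := by
    by_contra! h
    exact hXa (Finset.eq_singleton_iff_nonempty_unique_mem.2 ⟨hX, h⟩)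
  refine ⟨fun y => ?_, x, ?_⟩
  · by_cases hy : y = a
    · rw [hy, h1]; exact setProb_le_one _ _ _
    · rw [h0 y hy]; exact div_nonneg (Nat.cast_nonneg _) (Nat.cast_nonneg _)
  · rw [h0 x hxa]
    refine div_pos (Nat.cast_pos.2 (Finset.card_pos.2 ⟨x, ?_⟩))
      (Nat.cast_pos.2 (Finset.card_pos.2 hX))
    exact Finset.mem_filter.2 ⟨hx, Or.inr hxa⟩

theorem WeakSPset.not_strictSDset_update {B W : Type*}
    {f : (W → WeakPref B) → Finset B} (hsp : WeakSPset f)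
    (R : W → WeakPref B) (v : W) (P : WeakPref B) :
    ¬ StrictSDset (R v).rel (f (Function.update R v P)) (f R) :=
  hsp R _ v fun w hw => by simp [hw]

theorem WeakSPset.not_strictSDset_of_update {B W : Type*}
    {f : (W → WeakPref B) → Finset B} (hsp : WeakSPset f)
    (R : W → WeakPref B) (v : W) (P : WeakPref B) :
    ¬ StrictSDset P.rel (f R) (f (Function.update R v P)) := by
  simpa using hsp.not_strictSDset_update (Function.update R v P) v (R v)

/-- The choice from the profile in which a coalition prefers `e 0` to the indifferent `e 1` and
`e 2`, and all others have the reverse preference. -/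
theorem choice_eq_of_decisive_insert {f : (V → WeakPref A) → Finset A} {K : Finset V} {i j : V}
    (hne : ∀ R, (f R).Nonempty) (hsp : WeakSPset f) (heff : ExPostEffSet f) (hK : K.Nonempty)
    (hi : i ∉ K) (hj : j ∉ K) (hij : i ≠ j) (hI : Decisive f (insert i K))
    (hJ : Decisive f (insert j K)) (e : Fin 3 ↪ A) {R : V → WeakPref A}
    (hRK : ∀ v ∈ K, R v = rankPref e ![0, 1, 1]) (hRo : ∀ v ∉ K, R v = rankPref e ![1, 0, 0]) :
    f R = {e 0} ∨ f R = {e 1} ∨ f R = {e 0, e 2} := by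
  set g : (V → Fin 3 → Fin 3) → Finset (Fin 3) :=
    fun R => Finset.univ.filter fun t => e t ∈ f fun v => rankPref e (R v) with hg
  have hgf : ∀ R, (g R).map e = f fun v => rankPref e (R v) := by
    intro R
    ext x
    simp only [hg, Finset.mem_map, Finset.mem_filter, Finset.mem_univ, true_and]
    refine ⟨by rintro ⟨t, ht, rfl⟩; exact ht, fun hx => ?_⟩
    by_cases hxe : x ∈ Set.range e
    · obtain ⟨t, rfl⟩ := hxe
      exact ⟨t, hx, rfl⟩
    · exact absurd hx (heff _ x ⟨e 0, fun v => rankPref.rel_of_notMem_range 0 hxe, i,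
        rankPref.not_rel_of_notMem_range 0 hxe⟩)
  have hgne : ∀ R, (g R).Nonempty := fun R => by
    rw [← Finset.map_nonempty (f := e), hgf]; exact hne _
  have hdec : ∀ G : Finset V, Decisive f G → G.Nonempty → ∀ (R : V → Fin 3 → Fin 3) p,
      (∀ v ∈ G, R v = p) → ∀ x ∈ g R, ∀ y, p x ≤ p y := by
    rintro G hG ⟨k, hk⟩ R p hR x hx y
    have := hG (fun v => rankPref e (R v)) (fun v hv w hw => by rw [hR v hv, hR w hw]) k hk
      (hgf R ▸ Finset.mem_map_of_mem e hx)
    simpa [hR k hk] using mem_tops.1 this (e y)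
  have hG := contractionRule_of_rule (g := g) hK hi hj hij hgne
    (fun R v p hd => hsp.not_strictSDset_update (fun v => rankPref e (R v)) v (rankPref e p) (by
      have := rankPref.strictSDset_map (e := e) (hgne _) (hgne _) hd
      rw [hgf, hgf] at this
      convert this using 2
      funext w
      by_cases hw : w = v
      · subst hw; simp
      · simp [hw]))
    (fun R x y hle ⟨v, hv⟩ hy => heff (fun v => rankPref e (R v)) (e y)
      ⟨e x, fun w => by simpa using hle w, v, by simpa using hv⟩ (by simpa [hg] using hy))
    (hdec _ hI (by simp)) (hdec _ hJ (by simp))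
  have hR : R = fun v => rankPref e (if v ∈ K then ![0, 1, 1] else if v = i then ![1, 0, 0]
      else if v = j then ![1, 0, 0] else ![1, 0, 0]) := by
    funext v
    by_cases hv : v ∈ K
    · simp [hv, hRK]
    · simp [hv, hRo]
  rw [hR, ← hgf]
  rcases hG.choice_cases with h | h | h <;> rw [h] <;> simp

/-- A coalition is decisive if its two extensions by a single voter are. -/
theorem decisive_of_decisive_insert {f : (V → WeakPref A) → Finset A} {K : Finset V} {i j : V}
    (hm : 3 ≤ Fintype.card A) (hne : ∀ R, (f R).Nonempty) (hsp : WeakSPset f)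
    (heff : ExPostEffSet f) (hK : K.Nonempty) (hi : i ∉ K) (hj : j ∉ K) (hij : i ≠ j)
    (hI : Decisive f (insert i K)) (hJ : Decisive f (insert j K)) : Decisive f K := by
  intro R hR k hk
  have hRK : ∀ v ∈ K, R v = R k := fun v hv => hR v hv k hk
  have : Nonempty A := Fintype.card_pos_iff.1 (by omega)
  obtain ⟨a, ha⟩ := tops_nonempty (R k)
  obtain ⟨e, rfl⟩ : ∃ e : Fin 3 ↪ A, e 0 = a := by
    obtain ⟨e⟩ := Function.Embedding.nonempty_of_card_le (α := Fin 3) (β := A) (by simpa using hm)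
    exact ⟨e.trans (Equiv.swap (e 0) a).toEmbedding, by simp⟩
  set W : V → WeakPref A :=
    fun v => if v ∈ K then rankPref e ![0, 1, 1] else rankPref e ![1, 0, 0] with hW
  have hfW : f W = {e 0} := by
    have hswap : ∀ ρ : Fin 3 → Fin 3, ρ 1 = ρ 2 →
        rankPref ((Equiv.swap 1 2 : Equiv.Perm (Fin 3)).toEmbedding.trans e) ρ = rankPref e ρ := by
      intro ρ hρ
      conv_lhs => rw [show ρ = ρ ∘ (Equiv.swap 1 2 : Equiv.Perm (Fin 3)) by
        funext t; fin_cases t <;> simp [hρ, Equiv.swap_apply_of_ne_of_ne]]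
      exact rankPref.comp_perm _
    have h1 := choice_eq_of_decisive_insert hne hsp heff hK hi hj hij hI hJ e (R := W)
      (fun v hv => by simp [hW, hv]) (fun v hv => by simp [hW, hv])
    have h2 := choice_eq_of_decisive_insert hne hsp heff hK hi hj hij hI hJ
      ((Equiv.swap 1 2 : Equiv.Perm (Fin 3)).toEmbedding.trans e) (R := W)
      (fun v hv => by rw [hswap _ rfl]; simp [hW, hv])
      (fun v hv => by rw [hswap _ rfl]; simp [hW, hv])
    simp only [Function.Embedding.trans_apply, Equiv.toEmbedding_apply, Equiv.swap_apply_left,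
      Equiv.swap_apply_right, Equiv.swap_apply_of_ne_of_ne (show (0 : Fin 3) ≠ 1 by decide)
      (show (0 : Fin 3) ≠ 2 by decide)] at h2
    have h01 : e 0 ≠ e 1 := by simp
    have h02 : e 0 ≠ e 2 := by simp
    have h12 : e 1 ≠ e 2 := by simp
    rcases h1 with h1 | h1 | h1
    · exact h1
    all_goals
      simp only [h1, Finset.ext_iff, Finset.mem_singleton, Finset.mem_insert] at h2
      rcases h2 with h2 | h2 | h2
      all_goals
        have := h2 (e 0)
        have := h2 (e 1)
        have := h2 (e 2)
        grind
  have hfB : f (fun v => if v ∈ K then rankPref e ![0, 1, 1] else bottomPref (e 0)) = {e 0} := by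
    refine profile_induction (Inv := fun Q => f Q = {e 0}) (fun Q v hv hQ hQv hInv => ?_) hfW
    have hvK : v ∉ K := fun hvK => hv (by simp [hW, hvK])
    simp only [hvK, if_false]
    by_contra hX
    set Q' := Function.update Q v (bottomPref (e 0)) with hQ'
    have hQK : ∀ w ∈ K, Q' w = rankPref e ![0, 1, 1] := fun w hw => by
      have hwv : w ≠ v := fun h => hvK (h ▸ hw)
      simpa [hQ', hwv, hW, hw] using hQ w
    have hQo : ∀ w ∉ K, Q' w = rankPref e ![1, 0, 0] ∨ Q' w = bottomPref (e 0) := fun w hw => by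
      by_cases hwv : w = v
      · simp [hQ', hwv]
      · simpa [hQ', hwv, hW, hw] using hQ w
    have hran : ∀ x ∈ f Q', x ∈ Set.range e := by
      intro x hx
      by_contra hxe
      refine heff Q' x ⟨e 1, fun w => ?_, k, ?_⟩ hx
      · by_cases hw : w ∈ K
        · rw [hQK w hw]; exact rankPref.rel_of_notMem_range 1 hxe
        · rcases hQo w hw with h | h <;> rw [h]
          · exact rankPref.rel_of_notMem_range 1 hxe
          · exact Or.inr (by simp)
      · rw [hQK k hk]; exact rankPref.not_rel_of_notMem_range 1 hxe
    obtain ⟨X, hXf⟩ : ∃ X : Finset (Fin 3), X.map e = f Q' := by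
      refine ⟨Finset.univ.filter fun t => e t ∈ f Q', ?_⟩
      ext x
      simp only [Finset.mem_map, Finset.mem_filter, Finset.mem_univ, true_and]
      refine ⟨by rintro ⟨t, ht, rfl⟩; exact ht, fun hx => ?_⟩
      obtain ⟨t, rfl⟩ := hran x hx
      exact ⟨t, hx, rfl⟩
    have hXne : X.Nonempty := by rw [← Finset.map_nonempty (f := e), hXf]; exact hne _
    have hX0 : X ≠ {0} := by rintro rfl; exact hX (by simpa using hXf.symm)
    have hd := rankPref.strictSDset_map (e := e) hXne (Finset.singleton_nonempty 0)
      ((by decide : ∀ X : Finset (Fin 3), X.Nonempty → X ≠ {0} → RankDom ![1, 0, 0] X {0})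
        X hXne hX0)
    rw [hXf, Finset.map_singleton, ← hInv] at hd
    have := hsp.not_strictSDset_update Q v (bottomPref (e 0))
    simp only [hQv, hW, hvK, if_false] at this
    exact this hd
  have hfR : f (fun v => if v ∈ K then rankPref e ![0, 1, 1] else R v) = {e 0} := by
    refine profile_induction (Inv := fun Q => f Q = {e 0}) (fun Q v hv hQ hQv hInv => ?_) hfB
    have hvK : v ∉ K := fun hvK => hv (by simp [hvK])
    by_contra hX
    have := hsp.not_strictSDset_update Q v (R v)
    simp only [hvK, if_false] at hQv hX
    rw [hQv, hInv] at this
    exact this (strictSDset_bottomPref (hne _) hX)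
  refine profile_induction (Inv := fun Q => f Q ⊆ tops (R k).rel) (fun Q v hv hQ hQv hInv => ?_)
    (hfR ▸ Finset.singleton_subset_iff.2 ha)
  have hvK : v ∈ K := by
    by_contra hvK
    exact hv (by simp [hvK])
  by_contra hX
  rw [hRK v hvK] at hX
  exact hsp.not_strictSDset_of_update Q v (R k) (strictSDset_of_subset_tops _ (hne _) hInv hX)

/-- Contraction lemma: if `I` and `J` are decisive coalitions of equal size `1 < |I| < n`
differing in exactly one voter each, then `I ∩ J` is decisive. -/
theorem decisive_contraction
    (hm : 3 ≤ Fintype.card A) (hn : 2 ≤ Fintype.card V)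
    (f : (V → WeakPref A) → Finset A) (hne : ∀ R, (f R).Nonempty)
    (hsp : WeakSPset f) (heff : ExPostEffSet f)
    (I J : Finset V) (hI : Decisive f I) (hJ : Decisive f J)
    (h1 : 1 < I.card) (heq : I.card = J.card) (h2 : J.card < Fintype.card V)
    (hIJ : (I \ J).card = 1) (hJI : (J \ I).card = 1) :
    Decisive f (I ∩ J) := by
  have hsub : ∀ {S T : Finset V} {i : V}, S \ T = {i} → insert i (S ∩ T) = S ∧ i ∈ S ∧ i ∉ T := by
    intro S T i h
    have hi : i ∈ S \ T := h ▸ Finset.mem_singleton_self i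
    rw [Finset.mem_sdiff] at hi
    refine ⟨?_, hi⟩
    rw [Finset.insert_eq, ← h, Finset.sdiff_union_inter]
  obtain ⟨i, hi⟩ := Finset.card_eq_one.1 hIJ
  obtain ⟨j, hj⟩ := Finset.card_eq_one.1 hJI
  obtain ⟨hI', hiI, hiJ⟩ := hsub hi
  obtain ⟨hJ', hjJ, hjI⟩ := hsub hj
  rw [Finset.inter_comm] at hJ'
  have hK : (I ∩ J).Nonempty := by
    have := Finset.card_sdiff_add_card_inter I J
    exact Finset.card_pos.1 (by omega)
  exact decisive_of_decisive_insert hm hne hsp heff hK (by simp [hiJ]) (by simp [hjI])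
    (by rintro rfl; exact hiJ hjJ) (hI'.symm ▸ hI) (hJ'.symm ▸ hJ)
end

section
/- Let f be an even-chance SDS on weak preference profiles (m ≥ 3, n ≥ 2) that is weakly strategyproof and ex post efficient, and let G be the set of weak dictators of f (voters i such that f(R) ∩ T_i(R) ≠ ∅ for every profile R). Then 1 ≤ |G| ≤ 2 and G is decisive for f. -/
open Classical Finset

variable {A V : Type*} [Fintype A] [Fintype V]

set_option linter.unusedSectionVars false

/-- The probability of `S` under the uniform lottery over `X`. -/
noncomputable def prob (X S : Finset A) : ℝ := ((X ∩ S).card : ℝ) / X.card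

/-- The alternatives that are at least as good as `x` for the utility function `w`. -/
noncomputable def upperSet (w : A → ℕ) (x : A) : Finset A := univ.filter (fun y => w x ≤ w y)

/-- The utility function with indifference classes `P`, `S \ P` and the rest, best first. -/
noncomputable def tier (P S : Finset A) : A → ℕ :=
  fun x => if x ∈ P then 2 else if x ∈ S then 1 else 0

/-- A weakly strategyproof and ex post efficient rule on profiles of utility functions. -/
structure IsGoodRule (F : (V → A → ℕ) → Finset A) : Prop where
  nonempty : ∀ u, (F u).Nonempty
  sp : ∀ u u' : V → A → ℕ, ∀ i, (∀ j, j ≠ i → u' j = u j) →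
    (∀ x, prob (F u) (upperSet (u i) x) ≤ prob (F u') (upperSet (u i) x)) →
    ∀ x, prob (F u') (upperSet (u i) x) ≤ prob (F u) (upperSet (u i) x)
  eff : ∀ (u : V → A → ℕ) (x y : A), (∀ i, u i y ≤ u i x) → (∃ i, u i y < u i x) → y ∉ F u

/-- The coalition `G` can enforce the dichotomous common goal `T`. -/
def Enforces (F : (V → A → ℕ) → Finset A) (G : Finset V) (T : Finset A) : Prop :=
  ∀ u : V → A → ℕ, (∀ i ∈ G, u i = tier ∅ T) → F u ⊆ T

/-- A coalition that can enforce any dichotomous common goal. -/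
def DichDecisive (F : (V → A → ℕ) → Finset A) (G : Finset V) : Prop :=
  ∀ T : Finset A, T.Nonempty → Enforces F G T

section Prob

lemma prob_nonneg (X S : Finset A) : 0 ≤ prob X S := by unfold prob; positivity

lemma prob_le_one (X S : Finset A) : prob X S ≤ 1 := by
  unfold prob
  apply div_le_one_of_le₀ _ (by positivity)
  exact_mod_cast card_le_card inter_subset_left

lemma prob_empty (X : Finset A) : prob X ∅ = 0 := by simp [prob]

lemma prob_eq_one_iff {X : Finset A} (hX : X.Nonempty) (S : Finset A) :
    prob X S = 1 ↔ X ⊆ S := by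
  have h : (0 : ℝ) < X.card := by exact_mod_cast hX.card_pos
  unfold prob
  rw [div_eq_one_iff_eq h.ne', Nat.cast_inj]
  constructor
  · intro h
    rw [← eq_of_subset_of_card_le inter_subset_left h.ge]
    exact inter_subset_right
  · intro h
    rw [inter_eq_left.2 h]

lemma prob_eq_zero_iff {X : Finset A} (S : Finset A) : prob X S = 0 ↔ ∀ x ∈ X, x ∉ S := by
  unfold prob
  rw [div_eq_zero_iff, Nat.cast_eq_zero, Nat.cast_eq_zero, card_eq_zero, card_eq_zero]
  constructor
  · rintro (h | h) x hx hS
    · exact notMem_empty x (h ▸ mem_inter.2 ⟨hx, hS⟩)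
    · simp [h] at hx
  · intro h
    left
    ext x
    simpa using h x

lemma prob_union (X : Finset A) {S T : Finset A} (h : Disjoint S T) :
    prob X (S ∪ T) = prob X S + prob X T := by
  unfold prob
  rw [inter_union_distrib_left, card_union_of_disjoint
    (h.mono inter_subset_right inter_subset_right)]
  push_cast
  ring

lemma prob_pair (X : Finset A) {a b : A} (h : a ≠ b) :
    prob X {a, b} = prob X {a} + prob X {b} := by
  rw [← prob_union X (by simpa using h)]
  rfl

lemma prob_add_compl {X : Finset A} (hX : X.Nonempty) (S : Finset A) :
    prob X S + prob X Sᶜ = 1 := by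
  rw [← prob_union X disjoint_compl_right, prob_eq_one_iff hX, union_compl]
  exact subset_univ _

lemma prob_singleton (X : Finset A) (a : A) :
    prob X {a} = if a ∈ X then (1 : ℝ) / X.card else 0 := by
  unfold prob
  split_ifs with h
  · rw [inter_singleton_of_mem h]; simp
  · rw [inter_singleton_of_notMem h]; simp

/-- The probabilities in a uniform lottery over a nonempty set of at most three alternatives. -/
def UniformTriple (p q r : ℝ) : Prop :=
  (p = 1 ∧ q = 0 ∧ r = 0) ∨ (p = 0 ∧ q = 1 ∧ r = 0) ∨ (p = 0 ∧ q = 0 ∧ r = 1) ∨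
  (p = 1/2 ∧ q = 1/2 ∧ r = 0) ∨ (p = 1/2 ∧ q = 0 ∧ r = 1/2) ∨ (p = 0 ∧ q = 1/2 ∧ r = 1/2) ∨
  (p = 1/3 ∧ q = 1/3 ∧ r = 1/3)

lemma uniformTriple_prob {X : Finset A} (hX : X.Nonempty) {a b c : A} (hab : a ≠ b) (hac : a ≠ c)
    (hbc : b ≠ c) (h : X ⊆ {a, b, c}) :
    UniformTriple (prob X {a}) (prob X {b}) (prob X {c}) := by
  have hcard : X.card = (if a ∈ X then 1 else 0) + (if b ∈ X then 1 else 0)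
      + (if c ∈ X then 1 else 0) := by
    have : X = ({a, b, c} : Finset A).filter (· ∈ X) := by
      ext x
      simp only [mem_filter]
      exact ⟨fun hx => ⟨h hx, hx⟩, fun hx => hx.2⟩
    conv_lhs => rw [this]
    rw [card_filter, sum_insert (by simp [hab, hac]), sum_insert (by simpa using hbc),
      sum_singleton, add_assoc]
  have hpos := hX.card_pos
  simp only [prob_singleton, hcard]
  unfold UniformTriple
  by_cases ha : a ∈ X <;> by_cases hb : b ∈ X <;> by_cases hc : c ∈ X <;>
    simp only [ha, hb, hc, if_true, if_false] at hcard ⊢ <;> norm_num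
  omega

lemma UniformTriple.sum {p q r : ℝ} (t : UniformTriple p q r) : p + q + r = 1 := by
  rcases t with t | t | t | t | t | t | t <;> linarith [t.1, t.2.1, t.2.2]

lemma UniformTriple.add_le {p q r : ℝ} (t : UniformTriple p q r) (hp : 0 < p) :
    q ≤ 1 / 2 ∧ r ≤ 1 / 2 ∧ q + r ≤ 2 / 3 := by
  rcases t with t | t | t | t | t | t | t <;> refine ⟨?_, ?_, ?_⟩ <;>
    linarith [t.1, t.2.1, t.2.2]

lemma UniformTriple.eq_zero_of_half {p q r : ℝ} (t : UniformTriple p q r) (hp : 0 < p) :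
    (q = 1 / 2 → r = 0) ∧ (r = 1 / 2 → q = 0) := by
  rcases t with t | t | t | t | t | t | t <;> constructor <;> intro <;>
    linarith [t.1, t.2.1, t.2.2]

lemma UniformTriple.eq_zero_of_add_le {p q r : ℝ} (t : UniformTriple p q r)
    (h : q + r ≤ 1 / 2) (hq : q ≠ 1 / 2) (hr : r ≠ 1 / 2) : q = 0 ∧ r = 0 := by
  rcases t with t | t | t | t | t | t | t
  · exact t.2
  · linarith [t.2.1, t.2.2]
  · linarith [t.2.1, t.2.2]
  · exact absurd t.2.1 hq
  · exact absurd t.2.2 hr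
  · exact absurd t.2.1 hq
  · linarith [t.2.1, t.2.2]

lemma UniformTriple.add_le_half {p q r : ℝ} (t : UniformTriple p q r) (hp : 0 < p)
    (h : q = 0 ∨ r = 0) : q + r ≤ 1 / 2 := by
  rcases t with t | t | t | t | t | t | t <;> rcases h with h | h <;>
    linarith [t.1, t.2.1, t.2.2]

end Prob

section Hybrid

/-- A property that is preserved when members of `C` change their reports one after the other is
preserved when all of them change their reports. -/
lemma of_single_changes {B : Type*} (C : Finset V) (u u' : V → B) (hC : ∀ j, j ∉ C → u' j = u j)
    (P : (V → B) → Prop)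
    (step : ∀ v v', ∀ i ∈ C, (∀ j, v j = u j ∨ v j = u' j) → v i = u i → v' i = u' i →
      (∀ j, j ≠ i → v' j = v j) → P v → P v')
    (h : P u) : P u' := by
  have key : ∀ s : Finset V, s ⊆ C → P (fun j => if j ∈ s then u' j else u j) := by
    intro s
    induction s using Finset.induction_on with
    | empty => intro _; simpa using h
    | insert i s hi ih =>
      intro hs
      refine step _ _ i (hs (mem_insert_self i s)) ?_ ?_ ?_ ?_
        (ih (fun x hx => hs (mem_insert_of_mem hx)))
      · intro j
        by_cases hj : j ∈ s <;> simp [hj]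
      · simp [hi]
      · simp
      · intro j hj
        simp [hj]
  have : u' = fun j => if j ∈ C then u' j else u j := by
    ext1 j
    by_cases hj : j ∈ C
    · simp [hj]
    · simp [hj, hC j hj]
  rw [this]
  exact key C subset_rfl

end Hybrid

namespace IsGoodRule

variable {F : (V → A → ℕ) → Finset A}

lemma upperSet_tier (P S : Finset A) (x : A) :
    upperSet (tier P S) x = if x ∈ P then P else if x ∈ S then P ∪ S else univ := by
  ext y
  simp only [upperSet, tier]
  by_cases h1 : x ∈ P <;> by_cases h2 : x ∈ S <;> by_cases h3 : y ∈ P <;> by_cases h4 : y ∈ S <;>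
    simp [h1, h2, h3, h4]

lemma prob_univ (h : IsGoodRule F) (u : V → A → ℕ) : prob (F u) univ = 1 :=
  (prob_eq_one_iff (h.nonempty u) _).2 (subset_univ _)

/-- Strategyproofness for a voter with (at most) three indifference classes. -/
lemma sp_tier (h : IsGoodRule F) {u u' : V → A → ℕ} {i : V} {P S : Finset A} (hi : u i = tier P S)
    (hu : ∀ j, j ≠ i → u' j = u j) (h1 : prob (F u) P ≤ prob (F u') P)
    (h2 : prob (F u) (P ∪ S) ≤ prob (F u') (P ∪ S)) :
    prob (F u') P ≤ prob (F u) P ∧ prob (F u') (P ∪ S) ≤ prob (F u) (P ∪ S) := by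
  have key := h.sp u u' i hu (by
    intro x
    rw [hi, upperSet_tier]
    split_ifs
    · exact h1
    · exact h2
    · rw [h.prob_univ, h.prob_univ])
  have hP : prob (F u') P ≤ prob (F u) P := by
    rcases P.eq_empty_or_nonempty with rfl | ⟨x, hx⟩
    · simp [prob_empty]
    · simpa [hi, upperSet_tier, hx] using key x
  refine ⟨hP, ?_⟩
  by_cases hS : ∃ x ∈ S, x ∉ P
  · obtain ⟨x, hx, hx'⟩ := hS
    simpa [hi, upperSet_tier, hx, hx'] using key x
  · push Not at hS
    rwa [union_eq_left.2 hS]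

/-- Coalitional strategyproofness for a common dichotomous preference. -/
lemma dich (h : IsGoodRule F) {u u' : V → A → ℕ} (C : Finset V) {T : Finset A}
    (hC : ∀ i ∈ C, u i = tier ∅ T) (hu : ∀ j, j ∉ C → u' j = u j) :
    prob (F u') T ≤ prob (F u) T := by
  refine of_single_changes C u' u (fun j hj => (hu j hj).symm)
    (fun v => prob (F u') T ≤ prob (F v) T) ?_ le_rfl
  intro v v' i hi _ _ hv' hvv hP
  refine hP.trans ?_
  by_contra hlt
  have := (h.sp_tier (u := v') (u' := v) (i := i) (P := ∅) (S := T) (by rw [hv', hC i hi])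
    (fun j hj => (hvv j hj).symm) (by simp [prob_empty])
    (by rw [empty_union]; exact (not_le.1 hlt).le)).2
  rw [empty_union] at this
  exact hlt this

lemma dich_single (h : IsGoodRule F) {u u' : V → A → ℕ} {i : V} {T : Finset A}
    (hi : u i = tier ∅ T) (hu : ∀ j, j ≠ i → u' j = u j) :
    prob (F u') T ≤ prob (F u) T :=
  h.dich {i} (by simpa using hi) (by simpa using hu)

lemma subset_iff (h : IsGoodRule F) (u : V → A → ℕ) (S : Finset A) :
    F u ⊆ S ↔ prob (F u) S = 1 := (prob_eq_one_iff (h.nonempty u) S).symm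

lemma subset_iff_compl (h : IsGoodRule F) (u : V → A → ℕ) (S : Finset A) :
    F u ⊆ S ↔ prob (F u) Sᶜ = 0 := by
  rw [h.subset_iff]
  have := prob_add_compl (h.nonempty u) S
  constructor <;> intro <;> linarith

/-- A coalition that wants `T` gets it whenever it gets it through some joint report. -/
lemma subset_of_dich (h : IsGoodRule F) {u u' : V → A → ℕ} (C : Finset V) {T : Finset A}
    (hC : ∀ i ∈ C, u i = tier ∅ T) (hu : ∀ j, j ∉ C → u' j = u j) (hF : F u' ⊆ T) :
    F u ⊆ T := by
  rw [h.subset_iff] at hF ⊢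
  have := h.dich C hC hu
  have := prob_le_one (F u) T
  linarith

/-- A coalition that dislikes exactly `T` and gets it cannot escape from it. -/
lemma subset_of_dich_compl (h : IsGoodRule F) {u u' : V → A → ℕ} (C : Finset V) {T : Finset A}
    (hC : ∀ i ∈ C, u i = tier ∅ Tᶜ) (hu : ∀ j, j ∉ C → u' j = u j) (hF : F u ⊆ T) :
    F u' ⊆ T := by
  rw [h.subset_iff_compl] at hF ⊢
  have := h.dich C hC hu
  have := prob_nonneg (F u') Tᶜ
  linarith

lemma subset_of_mixed (h : IsGoodRule F) {D I : Finset V} {S T : Finset A}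
    (hD : Enforces F D T) (hID : I ⊆ D) (hI : I.Nonempty)
    (hST : S ⊆ T) (hS : S.Nonempty) {u : V → A → ℕ} (hu : ∀ i ∈ I, u i = tier ∅ S)
    (hu' : ∀ i ∈ D, i ∉ I → u i = tier ∅ T) : F u ⊆ T := by
  obtain ⟨i₀, hi₀⟩ := hI
  obtain ⟨s, hs⟩ := hS
  have hsT := hST hs
  by_cases hw : ∀ v, v ∈ D
  · intro x hx
    by_contra hxT
    have hxS : x ∉ S := fun hh => hxT (hST hh)
    refine h.eff u s x (fun i => ?_) ⟨i₀, ?_⟩ hx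
    · by_cases hi : i ∈ I
      · simp [hu i hi, tier, hs, hxS]
      · simp [hu' i (hw i) hi, tier, hsT, hxT]
    · simp [hu i₀ hi₀, tier, hs, hxS]
  push Not at hw
  obtain ⟨w, hw⟩ := hw
  let u₀ : V → A → ℕ := fun v => if v ∈ D then tier ∅ T else tier Tᶜ S
  let u₁ : V → A → ℕ :=
    fun v => if v ∈ I then tier ∅ S else if v ∈ D then tier ∅ T else tier Tᶜ S
  let u₂ : V → A → ℕ :=
    fun v => if v ∈ I then tier ∅ S else if v ∈ D then tier ∅ T else tier ∅ Tᶜ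
  have h₀ : F u₀ ⊆ S := by
    intro x hx
    have hxT : x ∈ T := hD u₀ (fun i hi => by simp [u₀, hi]) hx
    by_contra hxS
    refine h.eff u₀ s x (fun i => ?_) ⟨w, ?_⟩ hx
    · by_cases hi : i ∈ D <;> simp [u₀, hi, tier, hs, hsT, hxT, hxS]
    · simp [u₀, hw, tier, hs, hsT, hxT, hxS]
  have h₁ : F u₁ ⊆ S := by
    refine h.subset_of_dich (u' := u₀) I (fun i hi => by simp [u₁, hi]) (fun j hj => ?_) h₀
    simp [u₀, u₁, hj]
  have h₂ : F u₂ ⊆ S := by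
    refine of_single_changes Dᶜ u₁ u₂ (fun j hj => ?_) (fun v => F v ⊆ S) ?_ h₁
    · have hj' : j ∈ D := by simpa using hj
      simp [u₁, u₂, hj']
    intro v v' i hi hv hvi hv'i hvv hP
    have hi' : i ∉ D := by simpa using hi
    have hiI : i ∉ I := fun hh => hi' (hID hh)
    have hsub : F v' ⊆ Tᶜ ∪ S := by
      intro x hx
      by_contra hxx
      simp only [mem_union, mem_compl, not_or, not_not] at hxx
      obtain ⟨hxT, hxS⟩ := hxx
      have hv' : ∀ j, v' j = u₁ j ∨ v' j = u₂ j := by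
        intro j
        by_cases hj : j = i
        · subst hj; exact Or.inr hv'i
        · rw [hvv j hj]; exact hv j
      refine h.eff v' s x (fun j => ?_) ⟨i₀, ?_⟩ hx
      · rcases hv' j with hj | hj <;> rw [hj] <;> simp only [u₁, u₂] <;> split_ifs <;>
          simp [tier, hs, hsT, hxT, hxS]
      · rcases hv' i₀ with hj | hj <;> rw [hj] <;> simp [u₁, u₂, hi₀, tier, hs, hxS]
    have hv0 : prob (F v) Tᶜ = 0 :=
      (h.subset_iff_compl v T).1 (hP.trans hST)
    have hv1 : prob (F v') (Tᶜ ∪ S) = 1 := (h.subset_iff _ _).1 hsub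
    have := (h.sp_tier (u := v) (u' := v') (i := i) (P := Tᶜ) (S := S)
      (by rw [hvi]; simp [u₁, hiI, hi']) hvv (by rw [hv0]; exact prob_nonneg _ _)
      (by rw [hv1]; exact prob_le_one _ _)).1
    have hv'T : F v' ⊆ T := (h.subset_iff_compl v' T).2
      (le_antisymm (by linarith) (prob_nonneg _ _))
    intro x hx
    have := hsub hx
    have := hv'T hx
    simp_all
  refine h.subset_of_dich_compl (u := u₂) Dᶜ (fun i hi => ?_) (fun j hj => ?_) (h₂.trans hST)
  · have hi' : i ∉ D := by simpa using hi
    have hiI : i ∉ I := fun hh => hi' (hID hh)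
    simp [u₂, hi', hiI]
  · have hj' : j ∈ D := by simpa using hj
    by_cases hjI : j ∈ I
    · simp [u₂, hjI, hu j hjI]
    · simp [u₂, hjI, hj', hu' j hj' hjI]


lemma enforces_of_subset (h : IsGoodRule F) {D : Finset V} {S T : Finset A} (hDne : D.Nonempty)
    (hD : Enforces F D T) (hT : Tᶜ.Nonempty) (hST : S ⊆ T) (hS : S.Nonempty) :
    Enforces F D S := by
  intro u hu
  obtain ⟨s, hs⟩ := hS
  obtain ⟨i₀, hi₀⟩ := hDne
  by_cases hw : ∀ v, v ∈ D
  · intro x hx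
    by_contra hxS
    refine h.eff u s x (fun i => ?_) ⟨i₀, ?_⟩ hx
    · simp [hu i (hw i), tier, hs, hxS]
    · simp [hu i₀ hi₀, tier, hs, hxS]
  push Not at hw
  obtain ⟨w, hw⟩ := hw
  obtain ⟨c, hc⟩ := hT
  have hcT : c ∉ T := by simpa using hc
  have hcS : c ∉ S := fun hh => hcT (hST hh)
  let u' : V → A → ℕ := fun v => if v ∈ D then tier ∅ S else tier Tᶜ (T \ S)
  have h₁ : F u' ⊆ T := h.subset_of_mixed hD subset_rfl ⟨i₀, hi₀⟩ hST ⟨s, hs⟩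
    (fun i hi => by simp [u', hi]) (fun i hi hi' => absurd hi hi')
  have h₂ : F u' ⊆ S := by
    intro x hx
    have hxT := h₁ hx
    by_contra hxS
    refine h.eff u' c x (fun i => ?_) ⟨w, ?_⟩ hx
    · by_cases hi : i ∈ D <;> simp [u', hi, tier, hcT, hxT, hxS]
    · simp [u', hw, tier, hcT, hxT, hxS]
  refine of_single_changes Dᶜ u' u (fun j hj => ?_) (fun v => F v ⊆ S) ?_ h₂
  · have hj' : j ∈ D := by simpa using hj
    simp [u', hj', hu j hj']
  intro v v' i hi _ hvi _ hvv hP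
  have hi' : i ∉ D := by simpa using hi
  have hU : Tᶜ ∪ (T \ S) = Sᶜ := by
    ext x
    have := @hST x
    simp only [mem_union, mem_compl, mem_sdiff]
    tauto
  have h1 := (h.subset_iff_compl v T).1 (hP.trans hST)
  have h2 := (h.subset_iff_compl v S).1 hP
  have := (h.sp_tier (u := v) (u' := v') (i := i) (P := Tᶜ) (S := T \ S)
      (by rw [hvi]; simp [u', hi']) hvv (by rw [h1]; exact prob_nonneg _ _)
      (by rw [hU, h2]; exact prob_nonneg _ _)).2
  rw [hU, h2] at this
  exact (h.subset_iff_compl v' S).2 (le_antisymm this (prob_nonneg _ _))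

lemma enforces_mono (h : IsGoodRule F) {D : Finset V} {S T : Finset A}
    (hD : Enforces F D S) (hST : S ⊆ T) : Enforces F D T := by
  intro u hu
  refine h.subset_of_dich (u' := fun v => if v ∈ D then tier ∅ S else u v) D hu
    (fun j hj => by simp [hj]) ((hD _ fun i hi => by simp [hi]).trans hST)

/-- A coalition that gets its way in one conflict with everybody else gets its way always. -/
lemma dichDecisive_of_conflict [Nonempty V] (hm : 3 ≤ Fintype.card A) (h : IsGoodRule F)
    {D : Finset V} {T : Finset A} (hT : T.Nonempty) (hTc : Tᶜ.Nonempty) {u : V → A → ℕ}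
    (hu : ∀ i ∈ D, u i = tier ∅ T) (hu' : ∀ i, i ∉ D → u i = tier ∅ Tᶜ) (hF : F u ⊆ T) :
    DichDecisive F D := by
  have hDne : D.Nonempty := by
    by_contra hD
    rw [not_nonempty_iff_eq_empty] at hD
    subst hD
    obtain ⟨c, hc⟩ := hTc
    obtain ⟨x, hx⟩ := h.nonempty u
    have hxT := hF hx
    have hcT : c ∉ T := by simpa using hc
    refine h.eff u c x (fun i => ?_) ⟨Classical.arbitrary V, ?_⟩ hx
    · simp [hu' i, tier, hcT, hxT]
    · simp [hu', tier, hcT, hxT]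
  have e₁ : Enforces F D T := by
    intro v hv
    refine h.subset_of_dich_compl (u := u) Dᶜ (fun i hi => hu' i (by simpa using hi))
      (fun j hj => ?_) hF
    have hj : j ∈ D := by simpa using hj
    rw [hv j hj, hu j hj]
  obtain ⟨x, hx⟩ := hT
  have e₂ : Enforces F D {x} :=
    h.enforces_of_subset hDne e₁ hTc (by simpa using hx) (singleton_nonempty x)
  rintro T' ⟨y, hy⟩
  have e₃ : Enforces F D {x, y} := h.enforces_mono e₂ (by simp)
  have hxy : ({x, y} : Finset A)ᶜ.Nonempty := by
    rw [← card_pos, card_compl]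
    have := card_le_two (a := x) (b := y)
    omega
  exact h.enforces_mono (h.enforces_of_subset hDne e₃ hxy (by simp) (singleton_nonempty y))
    (by simpa using hy)

lemma dichDecisive_mono {D D' : Finset V} (hD : DichDecisive F D) (hDD : D ⊆ D') :
    DichDecisive F D' := fun T hT u hu => hD T hT u fun i hi => hu i (hDD hi)

lemma not_dichDecisive_of_disjoint (hm : 3 ≤ Fintype.card A) (h : IsGoodRule F)
    {D D' : Finset V} (hD : DichDecisive F D) (hDD : Disjoint D D') : ¬ DichDecisive F D' := by
  intro hD'
  obtain ⟨a, b, hab⟩ := Fintype.one_lt_card_iff.1 (show 1 < Fintype.card A by omega)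
  let u : V → A → ℕ := fun v => if v ∈ D then tier ∅ {a} else tier ∅ {b}
  have h₁ := hD {a} (by simp) u (fun i hi => by simp [u, hi])
  have h₂ := hD' {b} (by simp) u (fun i hi => by simp [u, disjoint_right.1 hDD hi])
  obtain ⟨x, hx⟩ := h.nonempty u
  have := h₁ hx
  have := h₂ hx
  simp_all

lemma dichDecisive_univ [Nonempty V] (h : IsGoodRule F) : DichDecisive F (univ : Finset V) := by
  rintro T ⟨s, hs⟩ u hu x hx
  by_contra hxT
  refine h.eff u s x (fun i => ?_) ⟨Classical.arbitrary V, ?_⟩ hx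
  · simp [hu i, tier, hs, hxT]
  · simp [hu, tier, hs, hxT]

lemma not_dichDecisive_empty [Nonempty V] (hm : 3 ≤ Fintype.card A) (h : IsGoodRule F) :
    ¬ DichDecisive F ∅ :=
  h.not_dichDecisive_of_disjoint hm h.dichDecisive_univ (disjoint_empty_right _)

/-- A coalition whose complement is not decisive gets something from its common goal. -/
lemma exists_mem_of_not_compl [Nonempty V] (hm : 3 ≤ Fintype.card A) (h : IsGoodRule F)
    {C : Finset V} (hC : ¬ DichDecisive F Cᶜ) {T : Finset A} (hT : T.Nonempty) {u : V → A → ℕ}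
    (hu : ∀ i ∈ C, u i = tier ∅ T) : ∃ x ∈ F u, x ∈ T := by
  by_contra! hx
  have hF : F u ⊆ Tᶜ := fun x hh => by simpa using hx x hh
  have hTc : Tᶜ.Nonempty := (h.nonempty u).mono hF
  let u' : V → A → ℕ := fun v => if v ∈ C then tier ∅ T else tier ∅ Tᶜ
  refine hC (h.dichDecisive_of_conflict (u := u') hm hTc (by simpa using hT) (fun i hi => ?_)
    (fun i hi => ?_) ?_)
  · have : i ∉ C := by simpa using hi
    simp [u', this]
  · have : i ∈ C := by simpa using hi
    simp [u', this]
  · refine h.subset_of_dich (u' := u) Cᶜ (fun i hi => ?_) (fun j hj => ?_) hF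
    · have : i ∉ C := by simpa using hi
      simp [u', this]
    · have : j ∈ C := by simpa using hj
      simp [u', this, hu]

/-- A voter whose opponents are not decisive always gets one of his best alternatives with
positive probability. -/
lemma exists_mem_top_of_not_compl (hn : 2 ≤ Fintype.card V) (hm : 3 ≤ Fintype.card A)
    (h : IsGoodRule F) {i : V} (hi : ¬ DichDecisive F ({i}ᶜ : Finset V)) (u : V → A → ℕ) :
    ∃ x ∈ F u, ∀ y, u i y ≤ u i x := by
  have : Nonempty V := ⟨i⟩
  have : Nontrivial V := Fintype.one_lt_card_iff_nontrivial.1 (by omega)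
  have : Nonempty A := Fintype.card_pos_iff.1 (by omega)
  obtain ⟨j, hj⟩ := exists_ne i
  let T : Finset A := univ.filter (fun x => ∀ y, u i y ≤ u i x)
  have hmT : ∀ x, x ∈ T ↔ ∀ y, u i y ≤ u i x := fun x => by simp [T]
  by_contra! hno
  have hF : F u ⊆ Tᶜ := by
    intro x hx
    obtain ⟨y, hy⟩ := hno x hx
    simp only [mem_compl, hmT]
    intro hh
    exact absurd (hh y) (by omega)
  obtain ⟨t, -, ht⟩ := exists_max_image (univ : Finset A) (u i) univ_nonempty
  have htT : t ∈ T := (hmT t).2 fun y => ht y (mem_univ _)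
  obtain ⟨s, hs, hsmax⟩ := exists_max_image Tᶜ (u i) ((h.nonempty u).mono hF)
  have hsT : s ∉ T := by simpa using hs
  let S : Finset A := Tᶜ.filter (fun y => u i s ≤ u i y)
  have hmS : ∀ x, x ∈ S ↔ x ∉ T ∧ u i s ≤ u i x := fun x => by simp [S]
  have hsS : s ∈ S := (hmS s).2 ⟨hsT, le_rfl⟩
  have hlt : ∀ x ∈ T, u i s < u i x := by
    intro x hx
    by_contra hle
    exact hsT ((hmT s).2 fun y => ((hmT x).1 hx y).trans (not_lt.1 hle))
  let u₁ : V → A → ℕ := fun v => if v = i then u i else tier ∅ Tᶜ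
  let u₂ : V → A → ℕ := fun v => if v = i then u i else tier ∅ S
  let u₃ : V → A → ℕ := fun v => if v = i then tier ∅ T else tier ∅ S
  have h₁ : F u₁ ⊆ S := by
    have h₁' : F u₁ ⊆ Tᶜ := by
      refine h.subset_of_dich (u' := u) {i}ᶜ (fun k hk => ?_) (fun k hk => ?_) hF
      · have : k ≠ i := by simpa using hk
        simp [u₁, this]
      · have : k = i := by simpa using hk
        simp [u₁, this]
    intro x hx
    have hxT : x ∉ T := by simpa using h₁' hx
    by_contra hxS
    have hxs : u i x < u i s := by
      by_contra hle
      exact hxS ((hmS x).2 ⟨hxT, not_lt.1 hle⟩)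
    refine h.eff u₁ s x (fun k => ?_) ⟨i, ?_⟩ hx
    · by_cases hk : k = i
      · simpa [u₁, hk] using hxs.le
      · simp [u₁, hk, tier, hsT, hxT]
    · simpa [u₁] using hxs
  have h₂ : F u₂ ⊆ S := by
    refine h.subset_of_dich (u' := u₁) {i}ᶜ (fun k hk => ?_) (fun k hk => ?_) h₁
    · have : k ≠ i := by simpa using hk
      simp [u₂, this]
    · have : k = i := by simpa using hk
      simp [u₁, u₂, this]
  have h₃ : F u₃ ⊆ T ∪ S := by
    intro x hx
    by_contra hxx
    simp only [mem_union, not_or] at hxx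
    refine h.eff u₃ s x (fun k => ?_) ⟨j, ?_⟩ hx
    · by_cases hk : k = i <;> simp [u₃, hk, tier, hsS, hsT, hxx]
    · simp [u₃, hj, tier, hsS, hxx]
  obtain ⟨t', ht', ht'T⟩ := h.exists_mem_of_not_compl hm (C := {i}) (by simpa using hi)
    ⟨t, htT⟩ (u := u₃) (by simp [u₃])
  have hui : u₂ i = u i := by simp [u₂]
  have key := h.sp u₂ u₃ i (fun k hk => by simp [u₂, u₃, hk]) (fun x => ?_) t
  · have h0 : prob (F u₂) (upperSet (u₂ i) t) = 0 := by
      rw [prob_eq_zero_iff, hui]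
      intro x hx
      have hxT := ((hmS x).1 (h₂ hx)).1
      have := hsmax x (by simpa using hxT)
      have := hlt t htT
      simp only [upperSet, mem_filter, mem_univ, true_and]
      omega
    rw [h0] at key
    have := (prob_eq_zero_iff _).1 (le_antisymm key (prob_nonneg _ _)) t' ht'
    apply this
    rw [hui]
    simpa [upperSet] using (hmT t').1 ht'T t
  · rw [hui]
    by_cases hxs : u i x ≤ u i s
    · have : prob (F u₃) (upperSet (u i) x) = 1 := by
        rw [← h.subset_iff]
        intro y hy
        simp only [upperSet, mem_filter, mem_univ, true_and]
        rcases mem_union.1 (h₃ hy) with hy | hy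
        · exact hxs.trans (hlt y hy).le
        · exact hxs.trans ((hmS y).1 hy).2
      rw [this]
      exact prob_le_one _ _
    · have : prob (F u₂) (upperSet (u i) x) = 0 := by
        rw [prob_eq_zero_iff]
        intro y hy
        have hyT := ((hmS y).1 (h₂ hy)).1
        have := hsmax y (by simpa using hyT)
        simp only [upperSet, mem_filter, mem_univ, true_and]
        omega
      rw [this]
      exact prob_nonneg _ _

/-- The profile where `i` reports `x`, `j` reports `y`, the voters in `C` report `w` and all other
voters report `z`. -/
noncomputable def prof (C : Finset V) (i j : V) (w x y z : A → ℕ) : V → A → ℕ :=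
  fun v => if v = i then x else if v = j then y else if v ∈ C then w else z

section Prof

variable {C : Finset V} {i j : V} {w x y z x' y' : A → ℕ} {a b c : A}

lemma prof_swap (hij : i ≠ j) : prof C j i w y x z = prof C i j w x y z := by
  ext1 v
  unfold prof
  by_cases h1 : v = i <;> by_cases h2 : v = j <;> simp_all

lemma prof_fst : prof C i j w x y z i = x := by simp [prof]

lemma prof_snd (hij : i ≠ j) : prof C i j w x y z j = y := by simp [prof, hij.symm]

lemma prof_mem (hi : i ∉ C) (hj : j ∉ C) {v : V} (hv : v ∈ C) : prof C i j w x y z v = w := by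
  have h1 : v ≠ i := by rintro rfl; exact hi hv
  have h2 : v ≠ j := by rintro rfl; exact hj hv
  simp [prof, h1, h2, hv]

lemma rank (h : IsGoodRule F) (hbc : b ≠ c) {u u' : V → A → ℕ} (hu : u i = tier {b} {c})
    (huu : ∀ k, k ≠ i → u' k = u k) (h1 : prob (F u) {b} ≤ prob (F u') {b})
    (h2 : prob (F u) {b} + prob (F u) {c} ≤ prob (F u') {b} + prob (F u') {c}) :
    prob (F u') {b} = prob (F u) {b} ∧ prob (F u') {c} = prob (F u) {c} := by
  have e : ({b} : Finset A) ∪ {c} = {b, c} := rfl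
  have := h.sp_tier hu huu h1 (by rwa [e, prob_pair _ hbc, prob_pair _ hbc])
  rw [e, prob_pair _ hbc, prob_pair _ hbc] at this
  constructor <;> linarith [this.1, this.2]

lemma rank_fst (h : IsGoodRule F) (hbc : b ≠ c)
    (h1 : prob (F (prof C i j w (tier {b} {c}) y z)) {b} ≤ prob (F (prof C i j w x' y z)) {b})
    (h2 : prob (F (prof C i j w (tier {b} {c}) y z)) {b} +
      prob (F (prof C i j w (tier {b} {c}) y z)) {c} ≤
      prob (F (prof C i j w x' y z)) {b} + prob (F (prof C i j w x' y z)) {c}) :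
    prob (F (prof C i j w x' y z)) {b} = prob (F (prof C i j w (tier {b} {c}) y z)) {b} ∧
    prob (F (prof C i j w x' y z)) {c} = prob (F (prof C i j w (tier {b} {c}) y z)) {c} :=
  h.rank (i := i) hbc prof_fst (fun k hk => by simp [prof, hk]) h1 h2

lemma rank_snd (h : IsGoodRule F) (hij : i ≠ j) (hbc : b ≠ c)
    (h1 : prob (F (prof C i j w x (tier {b} {c}) z)) {b} ≤ prob (F (prof C i j w x y' z)) {b})
    (h2 : prob (F (prof C i j w x (tier {b} {c}) z)) {b} +
      prob (F (prof C i j w x (tier {b} {c}) z)) {c} ≤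
      prob (F (prof C i j w x y' z)) {b} + prob (F (prof C i j w x y' z)) {c}) :
    prob (F (prof C i j w x y' z)) {b} = prob (F (prof C i j w x (tier {b} {c}) z)) {b} ∧
    prob (F (prof C i j w x y' z)) {c} = prob (F (prof C i j w x (tier {b} {c}) z)) {c} :=
  h.rank (i := j) hbc (prof_snd hij) (fun k hk => by simp [prof, hk]) h1 h2

lemma one_fst (h : IsGoodRule F) (b : A) (x' : A → ℕ) :
    prob (F (prof C i j w x' y z)) {b} ≤ prob (F (prof C i j w (tier ∅ {b}) y z)) {b} :=
  h.dich_single (i := i) prof_fst (fun k hk => by simp [prof, hk])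

lemma one_snd (h : IsGoodRule F) (hij : i ≠ j) (b : A) (y' : A → ℕ) :
    prob (F (prof C i j w x y' z)) {b} ≤ prob (F (prof C i j w x (tier ∅ {b}) z)) {b} :=
  h.dich_single (i := j) (prof_snd hij) (fun k hk => by simp [prof, hk])

lemma pair_fst (h : IsGoodRule F) (hbc : b ≠ c) (x' : A → ℕ) :
    prob (F (prof C i j w x' y z)) {b} + prob (F (prof C i j w x' y z)) {c} ≤
      prob (F (prof C i j w (tier ∅ {b, c}) y z)) {b} +
      prob (F (prof C i j w (tier ∅ {b, c}) y z)) {c} := by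
  rw [← prob_pair _ hbc, ← prob_pair _ hbc]
  exact h.dich_single (i := i) prof_fst (fun k hk => by simp [prof, hk])

lemma one_mem (h : IsGoodRule F) (hi : i ∉ C) (hj : j ∉ C) (b : A) (w' : A → ℕ) :
    prob (F (prof C i j w' x y z)) {b} ≤ prob (F (prof C i j (tier ∅ {b}) x y z)) {b} :=
  h.dich C (fun _ hk => prof_mem hi hj hk) (fun k hk => by simp [prof, hk])

lemma pair_mem (h : IsGoodRule F) (hi : i ∉ C) (hj : j ∉ C) (hbc : b ≠ c) (w' : A → ℕ) :
    prob (F (prof C i j w' x y z)) {b} + prob (F (prof C i j w' x y z)) {c} ≤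
      prob (F (prof C i j (tier ∅ {b, c}) x y z)) {b} +
      prob (F (prof C i j (tier ∅ {b, c}) x y z)) {c} := by
  rw [← prob_pair _ hbc, ← prob_pair _ hbc]
  exact h.dich C (fun _ hk => prof_mem hi hj hk) (fun k hk => by simp [prof, hk])

lemma prob_eq_zero_of_notMem {X : Finset A} (h : b ∉ X) : prob X {b} = 0 := by
  simp [prob_singleton, h]

lemma notMem_prof (h : IsGoodRule F) (hij : i ≠ j) (hi : i ∉ C) (hj : j ∉ C)
    (hw : w b ≤ w a) (hx : x b ≤ x a) (hy : y b ≤ y a) (hz : z b ≤ z a)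
    (hlt : (C.Nonempty ∧ w b < w a) ∨ x b < x a ∨ y b < y a) :
    b ∉ F (prof C i j w x y z) := by
  refine h.eff _ a b (fun v => ?_) ?_
  · unfold prof
    split_ifs <;> assumption
  · rcases hlt with ⟨⟨v, hv⟩, hlt⟩ | hlt | hlt
    · exact ⟨v, by rwa [prof_mem hi hj hv]⟩
    · exact ⟨i, by rwa [prof_fst]⟩
    · exact ⟨j, by rwa [prof_snd hij]⟩

lemma uniformTriple_prof (h : IsGoodRule F) (hij : i ≠ j) (hi : i ∉ C) (hj : j ∉ C)
    (hab : a ≠ b) (hac : a ≠ c) (hbc : b ≠ c)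
    (hd : ∀ d, d ≠ a → d ≠ b → d ≠ c → w d = 0 ∧ x d = 0 ∧ y d = 0 ∧ z d = 0) (e : A)
    (he : (C.Nonempty ∧ 0 < w e) ∨ 0 < x e ∨ 0 < y e) :
    UniformTriple (prob (F (prof C i j w x y z)) {a}) (prob (F (prof C i j w x y z)) {b})
      (prob (F (prof C i j w x y z)) {c}) := by
  refine uniformTriple_prob (h.nonempty _) hab hac hbc ?_
  intro d hdF
  by_contra hd'
  simp only [mem_insert, mem_singleton, not_or] at hd'
  obtain ⟨h1, h2, h3, h4⟩ := hd d hd'.1 hd'.2.1 hd'.2.2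
  refine h.notMem_prof (a := e) hij hi hj ?_ ?_ ?_ ?_ ?_ hdF <;> simp [h1, h2, h3, h4, he]

lemma prof_subset_of_mem (h : IsGoodRule F) (hi : i ∉ C) (hj : j ∉ C) {S T : Finset A}
    (hC : C.Nonempty) (hD : DichDecisive F (insert i C)) (hST : S ⊆ T) (hS : S.Nonempty) :
    F (prof C i j (tier ∅ S) (tier ∅ T) y z) ⊆ T := by
  refine h.subset_of_mixed (hD T (hS.mono hST)) (subset_insert i C) hC hST hS
    (fun v hv => prof_mem hi hj hv) (fun v hv hv' => ?_)
  obtain rfl : v = i := by simpa [hv'] using hv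
  exact prof_fst

lemma prof_subset_of_fst (h : IsGoodRule F) (hi : i ∉ C) (hj : j ∉ C) {S T : Finset A}
    (hD : DichDecisive F (insert i C)) (hST : S ⊆ T) (hS : S.Nonempty) :
    F (prof C i j (tier ∅ T) (tier ∅ S) y z) ⊆ T := by
  refine h.subset_of_mixed (I := {i}) (hD T (hS.mono hST)) (by simp) (by simp) hST hS
    (fun v hv => ?_) (fun v hv hv' => ?_)
  · obtain rfl : v = i := by simpa using hv
    exact prof_fst
  · have : v ∈ C := by
      rcases mem_insert.1 hv with rfl | hv
      · simp at hv'
      · exact hv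
    exact prof_mem hi hj this

lemma prof_subset_of_snd (h : IsGoodRule F) (hij : i ≠ j) (hi : i ∉ C) (hj : j ∉ C)
    {S T : Finset A} (hD : DichDecisive F (insert j C)) (hST : S ⊆ T) (hS : S.Nonempty) :
    F (prof C i j (tier ∅ T) x (tier ∅ S) z) ⊆ T := by
  rw [← prof_swap hij]
  exact h.prof_subset_of_fst hj hi hD hST hS

lemma prof_subset_of_compl (h : IsGoodRule F) (hij : i ≠ j) (hi : i ∉ C) (hj : j ∉ C)
    {S T : Finset A} (hD : DichDecisive F Cᶜ) (hST : S ⊆ T) (hS : S.Nonempty) :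
    F (prof C i j w (tier ∅ T) (tier ∅ S) (tier ∅ S)) ⊆ T := by
  refine h.subset_of_mixed (I := Cᶜ \ {i}) (hD T (hS.mono hST)) sdiff_subset
    ⟨j, by simpa using ⟨hj, hij.symm⟩⟩ hST hS (fun v hv => ?_) (fun v hv hv' => ?_)
  · simp only [mem_sdiff, mem_compl, mem_singleton] at hv
    simp [prof, hv]
  · obtain rfl : v = i := by simp_all
    exact prof_fst

end Prof

/-- A coalition `C` that is neither decisive nor has a decisive complement, but is decisive with
either of `i` and `j`, together with three alternatives. -/
structure IsPivotal (F : (V → A → ℕ) → Finset A) (C : Finset V) (i j : V) (a b c : A) : Prop where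
  nonempty : C.Nonempty
  not_compl : ¬ DichDecisive F Cᶜ
  not_dec : ¬ DichDecisive F C
  fst : DichDecisive F (insert i C)
  snd : DichDecisive F (insert j C)
  ne : i ≠ j
  fst_notMem : i ∉ C
  snd_notMem : j ∉ C
  ab : a ≠ b
  ac : a ≠ c
  bc : b ≠ c

namespace IsPivotal

variable {C : Finset V} {i j : V} {a b c : A}

/-- The members of `C` want `a`, and the others, except for `i` and `j`, want `b` or `c`. -/
noncomputable def profile (C : Finset V) (i j : V) (a b c : A) (x y : A → ℕ) : V → A → ℕ :=
  prof C i j (tier ∅ {a}) x y (tier ∅ {b, c})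

lemma swap (hp : IsPivotal F C i j a b c) : IsPivotal F C j i a c b :=
  ⟨hp.nonempty, hp.not_compl, hp.not_dec, hp.snd, hp.fst, hp.ne.symm, hp.snd_notMem,
    hp.fst_notMem, hp.ac, hp.ab, hp.bc.symm⟩

lemma profile_swap (hp : IsPivotal F C i j a b c) (x y : A → ℕ) :
    profile C j i a c b y x = profile C i j a b c x y := by
  rw [profile, profile, prof_swap hp.ne, pair_comm]

lemma triple [Nonempty V] (hm : 3 ≤ Fintype.card A) (h : IsGoodRule F)
    (hp : IsPivotal F C i j a b c) {x y : A → ℕ}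
    (hd : ∀ d, d ≠ a → d ≠ b → d ≠ c → x d = 0 ∧ y d = 0) :
    UniformTriple (prob (F (profile C i j a b c x y)) {a})
      (prob (F (profile C i j a b c x y)) {b}) (prob (F (profile C i j a b c x y)) {c}) ∧
    0 < prob (F (profile C i j a b c x y)) {a} := by
  obtain ⟨hC, hC', -, -, -, hij, hi, hj, hab, hac, hbc⟩ := hp
  constructor
  · refine h.uniformTriple_prof hij hi hj hab hac hbc (fun d h1 h2 h3 => ?_) a ?_
    · simp [hd d h1 h2 h3, tier, h1, h2, h3]
    · simp [hC, tier]
  · obtain ⟨t, ht, hta⟩ := h.exists_mem_of_not_compl hm hC' (T := {a}) (by simp)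
      (u := profile C i j a b c x y) (fun v hv => prof_mem hi hj hv)
    obtain rfl : t = a := by simpa using hta
    refine lt_of_le_of_ne (prob_nonneg _ _) fun h0 => ?_
    exact (prob_eq_zero_iff _).1 h0.symm t ht (by simp)

/-- If `i` and the voters outside agree on the pair and `j` insists on `c`, then the outcome is a
coin toss between `a` and `c`. -/
lemma outcome_pair_single [Nonempty V] (hm : 3 ≤ Fintype.card A) (h : IsGoodRule F)
    (hp : IsPivotal F C i j a b c) :
    prob (F (profile C i j a b c (tier ∅ {b, c}) (tier ∅ {c}))) {a} = 1 / 2 ∧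
    prob (F (profile C i j a b c (tier ∅ {b, c}) (tier ∅ {c}))) {b} = 0 ∧
    prob (F (profile C i j a b c (tier ∅ {b, c}) (tier ∅ {c}))) {c} = 1 / 2 := by
  have tX := hp.triple hm h (x := tier ∅ {b, c}) (y := tier ∅ {c})
    (fun d h1 h2 h3 => by simp [tier, h2, h3])
  obtain ⟨hC, hC', hD, hiC, hjC, hij, hi, hj, hab, hac, hbc⟩ := hp
  have hXb : prob (F (profile C i j a b c (tier ∅ {b, c}) (tier ∅ {c}))) {b} = 0 := by
    refine prob_eq_zero_of_notMem (h.notMem_prof (a := c) hij hi hj ?_ ?_ ?_ ?_ ?_) <;>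
      simp [tier, hab.symm, hac.symm, hbc]
  have tR : UniformTriple (prob (F (prof C i j (tier ∅ {a}) (tier ∅ {c}) (tier ∅ {c})
        (tier ∅ {c}))) {a}) (prob (F (prof C i j (tier ∅ {a}) (tier ∅ {c}) (tier ∅ {c})
        (tier ∅ {c}))) {b}) (prob (F (prof C i j (tier ∅ {a}) (tier ∅ {c}) (tier ∅ {c})
        (tier ∅ {c}))) {c}) := by
    refine h.uniformTriple_prof hij hi hj hab hac hbc (fun d h1 h2 h3 => ?_) a ?_
    · simp [tier, h1, h3]
    · simp [hC, tier]
  have hRb : prob (F (prof C i j (tier ∅ {a}) (tier ∅ {c}) (tier ∅ {c}) (tier ∅ {c}))) {b} = 0 := by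
    refine prob_eq_zero_of_notMem (h.notMem_prof (a := c) hij hi hj ?_ ?_ ?_ ?_ ?_) <;>
      simp [tier, hab.symm, hbc]
  have hRc : prob (F (prof C i j (tier ∅ {a}) (tier ∅ {c}) (tier ∅ {c}) (tier ∅ {c}))) {c} ≠ 0 := by
    obtain ⟨t, ht, hta⟩ := h.exists_mem_of_not_compl hm (C := Cᶜ) (by rwa [compl_compl])
      (T := {c}) (by simp) (u := prof C i j (tier ∅ {a}) (tier ∅ {c}) (tier ∅ {c}) (tier ∅ {c}))
      (fun v hv => by simp [prof, mem_compl.1 hv])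
    obtain rfl : t = c := by simpa using hta
    exact fun h0 => (prob_eq_zero_iff _).1 h0 t ht (by simp)
  have key : prob (F (prof C i j (tier ∅ {a}) (tier ∅ {c}) (tier ∅ {c}) (tier ∅ {c}))) {b, c} ≤
      prob (F (profile C i j a b c (tier ∅ {b, c}) (tier ∅ {c}))) {b, c} := by
    refine h.dich (Cᶜ \ {j}) (fun v hv => ?_) (fun v hv => ?_)
    · simp only [mem_sdiff, mem_compl, mem_singleton] at hv
      simp [profile, prof, hv]
    · by_cases hvj : v = j
      · simp [profile, prof, hvj, hij.symm]
      · have hv' : v ∈ C := by simpa [hvj] using hv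
        rw [profile, prof_mem hi hj hv', prof_mem hi hj hv']
  rw [prob_pair _ hbc, prob_pair _ hbc] at key
  obtain ⟨tX, hXa⟩ := tX
  unfold UniformTriple at tX tR
  refine ⟨?_, hXb, ?_⟩ <;> grind

lemma outcome_single_single_ne [Nonempty V] (hm : 3 ≤ Fintype.card A) (h : IsGoodRule F)
    (hp : IsPivotal F C i j a b c) :
    prob (F (profile C i j a b c (tier ∅ {b}) (tier ∅ {c}))) {c} ≠ 1 / 2 := by
  intro hJc
  have hX1 := hp.swap.outcome_pair_single hm h
  rw [pair_comm, hp.profile_swap] at hX1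
  obtain ⟨tJ, hJa⟩ := hp.triple hm h (x := tier ∅ {b}) (y := tier ∅ {c})
    (fun d h1 h2 h3 => by simp [tier, h2, h3])
  obtain ⟨tL, hLa⟩ := hp.triple hm h (x := tier {b} {a}) (y := tier ∅ {c})
    (fun d h1 h2 h3 => by simp [tier, h1, h2, h3])
  obtain ⟨tW, hWa⟩ := hp.triple hm h (x := tier ∅ {a, b}) (y := tier ∅ {c})
    (fun d h1 h2 h3 => by simp [tier, h1, h2, h3])
  obtain ⟨tM, hMa⟩ := hp.triple hm h (x := tier {b} {a}) (y := tier ∅ {b, c})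
    (fun d h1 h2 h3 => by simp [tier, h1, h2, h3])
  obtain ⟨tQ, hQa⟩ := hp.triple hm h (x := tier {b} {a}) (y := tier {c} {b})
    (fun d h1 h2 h3 => by simp [tier, h1, h2, h3])
  obtain ⟨tK, hKa⟩ := hp.triple hm h (x := tier ∅ {b}) (y := tier {c} {b})
    (fun d h1 h2 h3 => by simp [tier, h2, h3])
  obtain ⟨hC, hC', hD, hiC, hjC, hij, hi, hj, hab, hac, hbc⟩ := hp
  unfold profile at *
  have hWc : prob (F (prof C i j (tier ∅ {a}) (tier ∅ {a, b}) (tier ∅ {c}) (tier ∅ {b, c}))) {c}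
      = 0 :=
    prob_eq_zero_of_notMem fun hc => by
      have := h.prof_subset_of_mem hi hj hC hiC (S := {a}) (T := {a, b}) (by simp) (by simp) hc
      simp [hac.symm, hbc.symm] at this
  have hMc : prob (F (prof C i j (tier ∅ {a}) (tier {b} {a}) (tier ∅ {b, c}) (tier ∅ {b, c}))) {c}
      = 0 := by
    refine prob_eq_zero_of_notMem (h.notMem_prof (a := b) hij hi hj ?_ ?_ ?_ ?_ ?_) <;>
      simp [tier, hab.symm, hac.symm, hbc.symm]
  have s1 := h.one_fst (C := C) (i := i) (j := j) (w := tier ∅ {a}) (y := tier ∅ {c})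
    (z := tier ∅ {b, c}) b (tier {b} {a})
  have s2 := h.rank_fst (C := C) (i := i) (j := j) (w := tier ∅ {a}) (y := tier ∅ {c})
    (z := tier ∅ {b, c}) (x' := tier ∅ {a, b}) hab.symm
  have s3 := h.rank_fst (C := C) (i := i) (j := j) (w := tier ∅ {a}) (y := tier ∅ {b, c})
    (z := tier ∅ {b, c}) (x' := tier ∅ {b}) hab.symm
  have s4 := h.one_snd (C := C) (i := i) (j := j) (w := tier ∅ {a}) (x := tier {b} {a})
    (z := tier ∅ {b, c}) hij c (tier {c} {b})
  have s5 := h.rank_snd (C := C) (i := i) (j := j) (w := tier ∅ {a}) (x := tier {b} {a})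
    (z := tier ∅ {b, c}) (y' := tier ∅ {b, c}) hij hbc.symm
  have s6 := h.one_fst (C := C) (i := i) (j := j) (w := tier ∅ {a}) (y := tier {c} {b})
    (z := tier ∅ {b, c}) b (tier {b} {a})
  have s7 := h.rank_snd (C := C) (i := i) (j := j) (w := tier ∅ {a}) (x := tier ∅ {b})
    (z := tier ∅ {b, c}) (y' := tier ∅ {c}) hij hbc.symm
  generalize F (prof C i j (tier ∅ {a}) (tier ∅ {b}) (tier ∅ {c}) (tier ∅ {b, c})) = J at *
  generalize F (prof C i j (tier ∅ {a}) (tier ∅ {b}) (tier ∅ {b, c}) (tier ∅ {b, c})) = X at *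
  generalize F (prof C i j (tier ∅ {a}) (tier {b} {a}) (tier ∅ {c}) (tier ∅ {b, c})) = L at *
  generalize F (prof C i j (tier ∅ {a}) (tier ∅ {a, b}) (tier ∅ {c}) (tier ∅ {b, c})) = W at *
  generalize F (prof C i j (tier ∅ {a}) (tier {b} {a}) (tier ∅ {b, c}) (tier ∅ {b, c})) = M at *
  generalize F (prof C i j (tier ∅ {a}) (tier {b} {a}) (tier {c} {b}) (tier ∅ {b, c})) = Q at *
  generalize F (prof C i j (tier ∅ {a}) (tier ∅ {b}) (tier {c} {b}) (tier ∅ {b, c})) = K at *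
  have hJ : prob J {b} = 0 := (tJ.eq_zero_of_half hJa).2 hJc
  have hL : prob L {b} = 0 := by linarith [prob_nonneg L {b}]
  have hL' := s2 (by linarith [prob_nonneg W {b}])
    (by linarith [tL.sum, tW.sum, prob_nonneg L {c}, prob_nonneg W {b}])
  have hLc : prob L {c} = 0 := by linarith [tL.sum, tW.sum]
  have hM := s3 (by linarith [tM.add_le hMa]) (by linarith [tM.sum])
  have hQc : prob Q {c} = 0 := by linarith [prob_nonneg Q {c}]
  have hQ := s5 (by linarith) (by linarith [tQ.add_le hQa])
  have hK : prob K {b} = 1 / 2 := by linarith [(tK.add_le hKa).1]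
  have hKc : prob K {c} = 0 := (tK.eq_zero_of_half hKa).1 hK
  linarith [(s7 (by linarith) (by linarith)).1]

lemma outcome_rank_single [Nonempty V] (hm : 3 ≤ Fintype.card A) (h : IsGoodRule F)
    (hp : IsPivotal F C i j a b c)
    (hJ : prob (F (profile C i j a b c (tier ∅ {b}) (tier ∅ {c}))) {b} = 0) :
    prob (F (profile C i j a b c (tier {b} {c}) (tier ∅ {c}))) {b} = 0 ∧
    prob (F (profile C i j a b c (tier {b} {c}) (tier ∅ {c}))) {c} = 1 / 2 := by
  obtain ⟨hXa, hXb, hXc⟩ := hp.outcome_pair_single hm h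
  obtain ⟨tK, hKa⟩ := hp.triple hm h (x := tier {b} {c}) (y := tier ∅ {c})
    (fun d h1 h2 h3 => by simp [tier, h2, h3])
  have s1 := h.one_fst (C := C) (i := i) (j := j) (w := tier ∅ {a}) (y := tier ∅ {c})
    (z := tier ∅ {b, c}) b (tier {b} {c})
  have s2 := h.rank_fst (C := C) (i := i) (j := j) (w := tier ∅ {a}) (y := tier ∅ {c})
    (z := tier ∅ {b, c}) (x' := tier ∅ {b, c}) hp.bc
  unfold profile at *
  have hKb := le_antisymm (s1.trans hJ.le) (prob_nonneg _ _)
  refine ⟨hKb, ?_⟩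
  rw [← hXc]
  exact (s2 (by linarith) (by linarith [tK.add_le hKa])).2.symm

lemma contradiction [Nonempty V] (hm : 3 ≤ Fintype.card A) (h : IsGoodRule F)
    (hp : IsPivotal F C i j a b c) : False := by
  obtain ⟨hXa, hXb, hXc⟩ := hp.outcome_pair_single hm h
  obtain ⟨tJ, hJa⟩ := hp.triple hm h (x := tier ∅ {b}) (y := tier ∅ {c})
    (fun d h1 h2 h3 => by simp [tier, h2, h3])
  obtain ⟨tZ, hZa⟩ := hp.triple hm h (x := tier ∅ {b, c}) (y := tier {c} {b})
    (fun d h1 h2 h3 => by simp [tier, h2, h3])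
  have hJc := hp.outcome_single_single_ne hm h
  have hJb := hp.swap.outcome_single_single_ne hm h
  rw [hp.profile_swap] at hJb
  have hJ := h.pair_fst (C := C) (i := i) (j := j) (w := tier ∅ {a}) (y := tier ∅ {c})
    (z := tier ∅ {b, c}) hp.bc (tier ∅ {b})
  have hJ0 : prob (F (profile C i j a b c (tier ∅ {b}) (tier ∅ {c}))) {b} = 0 ∧
      prob (F (profile C i j a b c (tier ∅ {b}) (tier ∅ {c}))) {c} = 0 := by
    refine tJ.eq_zero_of_add_le ?_ hJb hJc
    unfold profile at *
    linarith
  obtain ⟨hKb, hKc⟩ := hp.outcome_rank_single hm h hJ0.1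
  have hK' := hp.swap.outcome_rank_single hm h
  rw [hp.profile_swap, hp.profile_swap] at hK'
  obtain ⟨hKc', hKb'⟩ := hK' hJ0.2
  have hZb : prob (F (profile C i j a b c (tier ∅ {b, c}) (tier {c} {b}))) {b} = 0 := by
    refine prob_eq_zero_of_notMem
      (h.notMem_prof (a := c) hp.ne hp.fst_notMem hp.snd_notMem ?_ ?_ ?_ ?_ ?_) <;>
      simp [tier, hp.ab.symm, hp.ac.symm, hp.bc]
  have hZ := tZ.add_le_half hZa (Or.inl hZb)
  have s1 := h.pair_fst (C := C) (i := i) (j := j) (w := tier ∅ {a}) (y := tier {c} {b})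
    (z := tier ∅ {b, c}) hp.bc (tier {b} {c})
  have s2 := h.rank_fst (C := C) (i := i) (j := j) (w := tier ∅ {a}) (y := tier {c} {b})
    (z := tier ∅ {b, c}) (x' := tier ∅ {b}) hp.bc
  have s3 := h.rank_snd (C := C) (i := i) (j := j) (w := tier ∅ {a}) (x := tier {b} {c})
    (z := tier ∅ {b, c}) (y' := tier ∅ {c}) hp.ne hp.bc.symm
  unfold profile at *
  generalize F (prof C i j (tier ∅ {a}) (tier {b} {c}) (tier {c} {b}) (tier ∅ {b, c})) = M at *
  have nb := prob_nonneg M {b}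
  have nc := prob_nonneg M {c}
  linarith [(s2 (by linarith) (by linarith)).1, (s3 (by linarith) (by linarith)).1]

end IsPivotal

/-- A coalition `C` that is decisive with either of `i` and `j` and whose complement is decisive. -/
structure IsSemipivotal (F : (V → A → ℕ) → Finset A) (C : Finset V) (i j : V) : Prop where
  nonempty : C.Nonempty
  compl : DichDecisive F Cᶜ
  fst : DichDecisive F (insert i C)
  snd : DichDecisive F (insert j C)
  ne : i ≠ j
  fst_notMem : i ∉ C
  snd_notMem : j ∉ C

namespace IsSemipivotal

variable {C : Finset V} {i j : V} {a b c : A}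

lemma swap (hp : IsSemipivotal F C i j) : IsSemipivotal F C j i :=
  ⟨hp.nonempty, hp.compl, hp.snd, hp.fst, hp.ne.symm, hp.snd_notMem, hp.fst_notMem⟩

lemma sum_eq_one (h : IsGoodRule F) (hp : IsSemipivotal F C i j) (hab : a ≠ b) (hac : a ≠ c)
    (hbc : b ≠ c) (w x y : A → ℕ)
    (hd : ∀ d, d ≠ a → d ≠ b → d ≠ c → w d = 0 ∧ x d = 0 ∧ y d = 0) (hw : 0 < w b) :
    prob (F (prof C i j w x y (tier ∅ {c}))) {a} + prob (F (prof C i j w x y (tier ∅ {c}))) {b} +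
      prob (F (prof C i j w x y (tier ∅ {c}))) {c} = 1 := by
  refine (h.uniformTriple_prof hp.ne hp.fst_notMem hp.snd_notMem hab hac hbc
    (fun d h1 h2 h3 => ?_) b (Or.inl ⟨hp.nonempty, hw⟩)).sum
  obtain ⟨e1, e2, e3⟩ := hd d h1 h2 h3
  exact ⟨e1, e2, e3, by simp [tier, h3]⟩

lemma outcome_compare (h : IsGoodRule F) (hp : IsSemipivotal F C i j) (hab : a ≠ b) (hac : a ≠ c)
    (hbc : b ≠ c) :
    prob (F (prof C i j (tier ∅ {a, b}) (tier ∅ {b}) (tier ∅ {a}) (tier ∅ {c}))) {c} = 0 ∧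
    prob (F (prof C i j (tier ∅ {b}) (tier ∅ {b, c}) (tier ∅ {c}) (tier ∅ {c}))) {a} = 0 ∧
    (prob (F (prof C i j (tier ∅ {a, b}) (tier ∅ {b}) (tier ∅ {a}) (tier ∅ {c}))) {b} ≤
      prob (F (prof C i j (tier ∅ {b}) (tier ∅ {b, c}) (tier ∅ {c}) (tier ∅ {c}))) {b} →
      1 ≤ prob (F (prof C i j (tier ∅ {a, b}) (tier ∅ {b}) (tier ∅ {a}) (tier ∅ {c}))) {b}) := by
  have tY := hp.sum_eq_one h hab hac hbc (tier ∅ {a, b}) (tier ∅ {b}) (tier ∅ {a})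
    (fun d h1 h2 h3 => by simp [tier, h1, h2]) (by simp [tier])
  have tZ := hp.sum_eq_one h hab hac hbc (tier ∅ {a, b}) (tier ∅ {b}) (tier {c} {a})
    (fun d h1 h2 h3 => by simp [tier, h1, h2, h3]) (by simp [tier])
  have tYp := hp.sum_eq_one h hab hac hbc (tier ∅ {b}) (tier ∅ {b, c}) (tier ∅ {c})
    (fun d h1 h2 h3 => by simp [tier, h2, h3]) (by simp [tier])
  have tYq := hp.sum_eq_one h hab hac hbc (tier ∅ {a, b}) (tier ∅ {b, c}) (tier ∅ {c})
    (fun d h1 h2 h3 => by simp [tier, h1, h2, h3]) (by simp [tier])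
  have tW := hp.sum_eq_one h hab hac hbc (tier ∅ {a, b}) (tier ∅ {c}) (tier {c} {a})
    (fun d h1 h2 h3 => by simp [tier, h1, h2, h3]) (by simp [tier])
  have tWc := hp.sum_eq_one h hab hac hbc (tier ∅ {a, b}) (tier ∅ {c}) (tier ∅ {c})
    (fun d h1 h2 h3 => by simp [tier, h1, h2, h3]) (by simp [tier])
  have tV := hp.sum_eq_one h hab hac hbc (tier ∅ {a, b}) (tier ∅ {b, c}) (tier {c} {a})
    (fun d h1 h2 h3 => by simp [tier, h1, h2, h3]) (by simp [tier])
  have tVp := hp.sum_eq_one h hab hac hbc (tier ∅ {b}) (tier ∅ {b, c}) (tier {c} {a})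
    (fun d h1 h2 h3 => by simp [tier, h1, h2, h3]) (by simp [tier])
  have tE := hp.sum_eq_one h hab hac hbc (tier ∅ {b}) (tier ∅ {b}) (tier {c} {a})
    (fun d h1 h2 h3 => by simp [tier, h1, h2, h3]) (by simp [tier])
  have tUp := hp.sum_eq_one h hab hac hbc (tier ∅ {b}) (tier {b} {c}) (tier {c} {a})
    (fun d h1 h2 h3 => by simp [tier, h1, h2, h3]) (by simp [tier])
  have tU := hp.sum_eq_one h hab hac hbc (tier ∅ {a, b}) (tier {b} {c}) (tier {c} {a})
    (fun d h1 h2 h3 => by simp [tier, h1, h2, h3]) (by simp [tier])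
  have tT := hp.sum_eq_one h hab hac hbc (tier ∅ {a, b}) (tier {b} {c}) (tier ∅ {a})
    (fun d h1 h2 h3 => by simp [tier, h1, h2, h3]) (by simp [tier])
  obtain ⟨hC, hD, hiC, hjC, hij, hi, hj⟩ := hp
  have hY : prob (F (prof C i j (tier ∅ {a, b}) (tier ∅ {b}) (tier ∅ {a}) (tier ∅ {c}))) {c}
      = 0 :=
    prob_eq_zero_of_notMem fun hx => by
      simpa [hab, hab.symm, hac, hac.symm, hbc, hbc.symm] using
        h.prof_subset_of_fst hi hj hiC (by simp) (by simp) hx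
  have hZ : prob (F (prof C i j (tier ∅ {a, b}) (tier ∅ {b}) (tier {c} {a}) (tier ∅ {c}))) {c}
      = 0 :=
    prob_eq_zero_of_notMem fun hx => by
      simpa [hab, hab.symm, hac, hac.symm, hbc, hbc.symm] using
        h.prof_subset_of_fst hi hj hiC (by simp) (by simp) hx
  have hYq : prob (F (prof C i j (tier ∅ {a, b}) (tier ∅ {b, c}) (tier ∅ {c}) (tier ∅ {c}))) {a}
      = 0 :=
    prob_eq_zero_of_notMem fun hx => by
      simpa [hab, hab.symm, hac, hac.symm, hbc, hbc.symm] using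
        h.prof_subset_of_compl hij hi hj hD (by simp) (by simp) hx
  have hVp : prob (F (prof C i j (tier ∅ {b}) (tier ∅ {b, c}) (tier {c} {a}) (tier ∅ {c}))) {a}
      = 0 :=
    prob_eq_zero_of_notMem fun hx => by
      simpa [hab, hab.symm, hac, hac.symm, hbc, hbc.symm] using
        h.prof_subset_of_mem hi hj hC hiC (by simp) (by simp) hx
  have hT : prob (F (prof C i j (tier ∅ {a, b}) (tier {b} {c}) (tier ∅ {a}) (tier ∅ {c}))) {c}
      = 0 :=
    prob_eq_zero_of_notMem fun hx => by
      simpa [hab, hab.symm, hac, hac.symm, hbc, hbc.symm] using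
        h.prof_subset_of_snd hij hi hj hjC (by simp) (by simp) hx
  have hYp : prob (F (prof C i j (tier ∅ {b}) (tier ∅ {b, c}) (tier ∅ {c}) (tier ∅ {c}))) {a}
      = 0 := by
    refine prob_eq_zero_of_notMem (h.notMem_prof (a := b) hij hi hj ?_ ?_ ?_ ?_ ?_) <;>
      simp [tier, hab, hac, hC]
  have hWc : prob (F (prof C i j (tier ∅ {a, b}) (tier ∅ {c}) (tier ∅ {c}) (tier ∅ {c}))) {c}
      = 1 := by
    rw [← h.subset_iff]
    refine hD {c} (by simp) _ fun v hv => ?_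
    simp [prof, mem_compl.1 hv]
  have hE : prob (F (prof C i j (tier ∅ {b}) (tier ∅ {b}) (tier {c} {a}) (tier ∅ {c}))) {b}
      = 1 := by
    rw [← h.subset_iff]
    refine hiC {b} (by simp) _ fun v hv => ?_
    rcases mem_insert.1 hv with rfl | hv
    · exact prof_fst
    · exact prof_mem hi hj hv
  have s1 := h.one_snd (C := C) (i := i) (j := j) (w := tier ∅ {a, b}) (x := tier ∅ {b})
    (z := tier ∅ {c}) hij a (tier {c} {a})
  have s2 := h.rank_snd (C := C) (i := i) (j := j) (w := tier ∅ {a, b}) (x := tier ∅ {b})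
    (z := tier ∅ {c}) (y' := tier ∅ {a}) hij hac.symm
  have s3 := h.one_mem (C := C) (i := i) (j := j) (x := tier ∅ {b, c}) (y := tier ∅ {c})
    (z := tier ∅ {c}) hi hj b (tier ∅ {a, b})
  have s4 := h.pair_mem (C := C) (i := i) (j := j) (x := tier ∅ {b, c}) (y := tier ∅ {c})
    (z := tier ∅ {c}) hi hj hab (tier ∅ {b})
  have s5 := h.rank_snd (C := C) (i := i) (j := j) (w := tier ∅ {a, b}) (x := tier ∅ {c})
    (z := tier ∅ {c}) (y' := tier ∅ {c}) hij hac.symm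
  have s6 := h.pair_fst (C := C) (i := i) (j := j) (w := tier ∅ {a, b}) (y := tier {c} {a})
    (z := tier ∅ {c}) hbc (tier ∅ {c})
  have s7 := h.one_snd (C := C) (i := i) (j := j) (w := tier ∅ {b}) (x := tier ∅ {b, c})
    (z := tier ∅ {c}) hij c (tier {c} {a})
  have s8 := h.rank_snd (C := C) (i := i) (j := j) (w := tier ∅ {b}) (x := tier ∅ {b, c})
    (z := tier ∅ {c}) (y' := tier ∅ {c}) hij hac.symm
  have s9 := h.one_mem (C := C) (i := i) (j := j) (x := tier ∅ {b, c}) (y := tier {c} {a})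
    (z := tier ∅ {c}) hi hj b (tier ∅ {a, b})
  have s10 := h.one_snd (C := C) (i := i) (j := j) (w := tier ∅ {a, b}) (x := tier ∅ {b, c})
    (z := tier ∅ {c}) hij c (tier {c} {a})
  have s11 := h.rank_fst (C := C) (i := i) (j := j) (w := tier ∅ {b}) (y := tier {c} {a})
    (z := tier ∅ {c}) (x' := tier ∅ {b}) hbc
  have s12 := h.pair_mem (C := C) (i := i) (j := j) (x := tier {b} {c}) (y := tier {c} {a})
    (z := tier ∅ {c}) hi hj hab (tier ∅ {b})
  have s13 := h.one_fst (C := C) (i := i) (j := j) (w := tier ∅ {a, b}) (y := tier ∅ {a})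
    (z := tier ∅ {c}) b (tier {b} {c})
  have s14 := h.rank_fst (C := C) (i := i) (j := j) (w := tier ∅ {a, b}) (y := tier ∅ {a})
    (z := tier ∅ {c}) (x' := tier ∅ {b}) hbc
  have s15 := h.rank_snd (C := C) (i := i) (j := j) (w := tier ∅ {a, b}) (x := tier {b} {c})
    (z := tier ∅ {c}) (y' := tier ∅ {a}) hij hac.symm
  have s16 := h.rank_fst (C := C) (i := i) (j := j) (w := tier ∅ {a, b}) (y := tier {c} {a})
    (z := tier ∅ {c}) (x' := tier ∅ {b}) hbc
  have s17 := h.rank_fst (C := C) (i := i) (j := j) (w := tier ∅ {a, b}) (y := tier {c} {a})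
    (z := tier ∅ {c}) (x' := tier ∅ {b, c}) hbc
  generalize F (prof C i j (tier ∅ {a, b}) (tier ∅ {b}) (tier ∅ {a}) (tier ∅ {c})) = Y at *
  generalize F (prof C i j (tier ∅ {a, b}) (tier ∅ {b}) (tier {c} {a}) (tier ∅ {c})) = Z at *
  generalize F (prof C i j (tier ∅ {b}) (tier ∅ {b, c}) (tier ∅ {c}) (tier ∅ {c})) = Y' at *
  generalize F (prof C i j (tier ∅ {a, b}) (tier ∅ {b, c}) (tier ∅ {c}) (tier ∅ {c})) = Y'' at *
  generalize F (prof C i j (tier ∅ {a, b}) (tier ∅ {c}) (tier {c} {a}) (tier ∅ {c})) = W at *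
  generalize F (prof C i j (tier ∅ {a, b}) (tier ∅ {c}) (tier ∅ {c}) (tier ∅ {c})) = W' at *
  generalize F (prof C i j (tier ∅ {a, b}) (tier ∅ {b, c}) (tier {c} {a}) (tier ∅ {c})) = H at *
  generalize F (prof C i j (tier ∅ {b}) (tier ∅ {b, c}) (tier {c} {a}) (tier ∅ {c})) = H' at *
  generalize F (prof C i j (tier ∅ {b}) (tier ∅ {b}) (tier {c} {a}) (tier ∅ {c})) = E at *
  generalize F (prof C i j (tier ∅ {b}) (tier {b} {c}) (tier {c} {a}) (tier ∅ {c})) = U' at *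
  generalize F (prof C i j (tier ∅ {a, b}) (tier {b} {c}) (tier {c} {a}) (tier ∅ {c})) = U at *
  generalize F (prof C i j (tier ∅ {a, b}) (tier {b} {c}) (tier ∅ {a}) (tier ∅ {c})) = T at *
  have nonneg := fun (X : Finset A) (x : A) => prob_nonneg X {x}
  have eYZ := s2 (by linarith) (by linarith)
  have eW := s5 (by linarith [nonneg W a, nonneg W b, nonneg W' a, nonneg W' b])
    (by linarith [nonneg W b, nonneg W' a])
  have eV' := s8 (by linarith) (by linarith)
  have eU' := s11 (by linarith [nonneg U' a, nonneg U' c])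
    (by linarith [nonneg U' a, nonneg E c])
  have hU : prob U {c} = 0 := by linarith [nonneg U c, nonneg U' a]
  have eT := s14 (by linarith) (by linarith)
  have hUa : prob T {a} ≤ prob U {a} := by
    by_contra hlt
    linarith [(s15 (by linarith) (by linarith)).2]
  have hUb : prob Z {b} ≤ prob U {b} := by
    by_contra hlt
    linarith [(s16 (by linarith) (by linarith)).1]
  refine ⟨hY, hYp, fun hle => ?_⟩
  have hHa := nonneg H a
  have hWa := nonneg W a
  have hWb := nonneg W b
  have hUa' := nonneg U a
  linarith [s17 (by linarith) (by linarith)]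

lemma outcome_subset (h : IsGoodRule F) (hp : IsSemipivotal F C i j) (hab : a ≠ b) (hac : a ≠ c)
    (hbc : b ≠ c) {u : V → A → ℕ} (hu : ∀ v ∈ C, u v = tier ∅ {b}) (hui : u i = tier ∅ {b, c})
    (hu' : ∀ v, v ∉ C → v ≠ i → u v = tier ∅ {c}) : F u ⊆ {c} := by
  have e : u = prof C i j (tier ∅ {b}) (tier ∅ {b, c}) (tier ∅ {c}) (tier ∅ {c}) := by
    ext1 v
    unfold prof
    split_ifs with h1 h2 h3
    · rw [h1, hui]
    · rw [h2, hu' j hp.snd_notMem hp.ne.symm]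
    · exact hu v h3
    · exact hu' v h3 h1
  obtain ⟨r1, r2, r3⟩ := hp.outcome_compare h hab hac hbc
  obtain ⟨-, -, r4⟩ := hp.swap.outcome_compare h hab.symm hbc hac
  have eY : prof C j i (tier ∅ {b, a}) (tier ∅ {a}) (tier ∅ {b}) (tier ∅ {c}) =
      prof C i j (tier ∅ {a, b}) (tier ∅ {b}) (tier ∅ {a}) (tier ∅ {c}) := by
    rw [prof_swap hp.ne, pair_comm]
  rw [eY] at r4
  have tY := h.uniformTriple_prof (w := tier ∅ {a, b}) (x := tier ∅ {b}) (y := tier ∅ {a})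
    (z := tier ∅ {c}) hp.ne hp.fst_notMem hp.snd_notMem hab hac hbc
    (fun d h1 h2 h3 => by simp [tier, h1, h2, h3]) b (by simp [tier])
  have tX := h.uniformTriple_prof (w := tier ∅ {b}) (x := tier ∅ {b, c}) (y := tier ∅ {c})
    (z := tier ∅ {c}) hp.ne hp.fst_notMem hp.snd_notMem hab hac hbc
    (fun d h1 h2 h3 => by simp [tier, h2, h3]) b (by simp [tier])
  rw [← e] at tX r2 r3
  rw [h.subset_iff]
  have n1 := prob_nonneg (F u) {b}
  generalize F (prof C i j (tier ∅ {a, b}) (tier ∅ {b}) (tier ∅ {a}) (tier ∅ {c})) = Y at *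
  have n2 := prob_nonneg
    (F (prof C j i (tier ∅ {a}) (tier ∅ {a, c}) (tier ∅ {c}) (tier ∅ {c}))) {a}
  have hY : prob Y {b} = 1 / 2 := by
    unfold UniformTriple at tY
    clear tX
    by_contra hne
    rcases tY with t | t | t | t | t | t | t
    · linarith [r3 (by linarith)]
    · linarith [r4 (by linarith)]
    · linarith
    · exact hne t.2.1
    · linarith
    · linarith
    · linarith
  have hX : prob (F u) {b} < 1 / 2 := by
    by_contra hle
    linarith [r3 (by linarith)]
  rcases tX with t | t | t | t | t | t | t <;> linarith

end IsSemipivotal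

lemma exists_isSemipivotal [Nonempty V] (hm : 3 ≤ Fintype.card A) (h : IsGoodRule F) {i : V}
    (hi : DichDecisive F ({i}ᶜ : Finset V)) {D : Finset V} (hiD : i ∉ D) (hD : ¬ DichDecisive F D)
    (hD' : DichDecisive F (insert i D)) : ∃ C j, D ⊆ C ∧ IsSemipivotal F C i j := by
  obtain ⟨C, hC, hmax⟩ := exists_max_image
    (univ.filter fun C : Finset V => D ⊆ C ∧ i ∉ C ∧ ¬ DichDecisive F C) card
    ⟨D, by simp [hiD, hD]⟩
  simp only [mem_filter, mem_univ, true_and] at hC hmax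
  obtain ⟨hDC, hiC, hCd⟩ := hC
  obtain ⟨j, hj, hji⟩ : ∃ j, j ∉ C ∧ j ≠ i := by
    by_contra! hno
    refine hCd (dichDecisive_mono hi fun v hv => ?_)
    by_contra hvC
    exact (by simpa using hv : v ≠ i) (hno v hvC)
  have hfst : DichDecisive F (insert i C) := dichDecisive_mono hD' (insert_subset_insert i hDC)
  have hsnd : DichDecisive F (insert j C) := by
    by_contra hno
    have := hmax (insert j C) ⟨hDC.trans (subset_insert j C), by simp [hiC, hji.symm], hno⟩
    rw [card_insert_of_notMem hj] at this
    omega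
  have hne : C.Nonempty := by
    by_contra hno
    rw [not_nonempty_iff_eq_empty] at hno
    subst hno
    exact h.not_dichDecisive_of_disjoint hm hfst (by simpa using hji.symm) hsnd
  refine ⟨C, j, hDC, hne, ?_, hfst, hsnd, hji.symm, hiC, hj⟩
  by_contra hcompl
  obtain ⟨a, b, c, hab, hac, hbc⟩ := Fintype.two_lt_card_iff.1 (show 2 < Fintype.card A by omega)
  exact IsPivotal.contradiction hm h (a := a) (b := b) (c := c)
    ⟨hne, hcompl, hCd, hfst, hsnd, hji.symm, hiC, hj, hab, hac, hbc⟩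

/-- The opponents of a member of a minimal decisive coalition are not decisive. -/
lemma not_dichDecisive_compl_singleton [Nonempty V] (hm : 3 ≤ Fintype.card A) (h : IsGoodRule F)
    {G : Finset V} (hG : DichDecisive F G) {i : V} (hi : i ∈ G)
    (hmin : ¬ DichDecisive F (G.erase i)) : ¬ DichDecisive F ({i}ᶜ : Finset V) := by
  intro hcompl
  obtain ⟨C, j, -, hC⟩ := h.exists_isSemipivotal hm hcompl (notMem_erase i G) hmin
    (by rwa [insert_erase hi])
  have hins : insert i (insert i C)ᶜ = Cᶜ := by
    ext v
    have := hC.fst_notMem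
    by_cases hv : v = i <;> simp_all
  obtain ⟨C', k, hCC, hC'⟩ := h.exists_isSemipivotal hm hcompl (D := (insert i C)ᶜ) (by simp)
    (h.not_dichDecisive_of_disjoint hm hC.fst disjoint_compl_right) (by rw [hins]; exact hC.compl)
  obtain ⟨a, b, c, hab, hac, hbc⟩ := Fintype.two_lt_card_iff.1 (show 2 < Fintype.card A by omega)
  let u : V → A → ℕ :=
    fun v => if v = i then tier ∅ {b, c} else if v ∈ C then tier ∅ {b} else tier ∅ {c}
  let u' : V → A → ℕ :=
    fun v => if v = i then tier ∅ {b, c} else if v ∈ C' then tier ∅ {c} else tier ∅ {b}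
  have hne : ∀ v ∈ C, v ≠ i := fun v hv hvi => hC.fst_notMem (hvi ▸ hv)
  have hne' : ∀ v ∈ C', v ≠ i := fun v hv hvi => hC'.fst_notMem (hvi ▸ hv)
  have h₁ : F u ⊆ {c} := hC.outcome_subset h hab hac hbc
    (fun v hv => by simp [u, hne v hv, hv]) (by simp [u])
    (fun v hv hvi => by simp [u, hvi, hv])
  have h₂ : F u' ⊆ {b} := hC'.outcome_subset h hac hab hbc.symm
    (fun v hv => by simp [u', hne' v hv, hv]) (by simp [u', pair_comm])
    (fun v hv hvi => by simp [u', hvi, hv])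
  have h₃ : F u ⊆ {b} := by
    refine h.subset_of_dich (u' := u') (C ∩ C') (fun v hv => ?_) (fun v hv => ?_) h₂
    · have hv := (mem_inter.1 hv).1
      simp [u, hne v hv, hv]
    · by_cases hvi : v = i
      · simp [u, u', hvi]
      · by_cases hvC : v ∈ C
        · have : v ∉ C' := fun hh => hv (mem_inter.2 ⟨hvC, hh⟩)
          simp [u, u', hvi, hvC, this]
        · have : v ∈ C' := hCC (by simp [hvi, hvC])
          simp [u, u', hvi, hvC, this]
  obtain ⟨x, hx⟩ := h.nonempty u
  have e1 := h₁ hx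
  have e2 := h₃ hx
  rw [mem_singleton] at e1 e2
  exact hbc (e2.symm.trans e1)

/-- A voter who always gets one of his best alternatives with positive probability. -/
def IsWeakDictator (F : (V → A → ℕ) → Finset A) (i : V) : Prop :=
  ∀ u : V → A → ℕ, ∃ x ∈ F u, ∀ y, u i y ≤ u i x

lemma mem_of_isWeakDictator (hm : 3 ≤ Fintype.card A) {G : Finset V} (hG : DichDecisive F G)
    {i : V} (hi : IsWeakDictator F i) : i ∈ G := by
  by_contra hiG
  obtain ⟨a, b, hab⟩ := Fintype.one_lt_card_iff.1 (show 1 < Fintype.card A by omega)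
  obtain ⟨x, hx, hxt⟩ := hi fun v => if v ∈ G then tier ∅ {a} else tier ∅ {b}
  have hxa := hG {a} (by simp) _ (fun v hv => by simp [hv]) hx
  obtain rfl : x = a := by simpa using hxa
  simpa [hiG, tier, hab] using hxt b

lemma subset_top_of_dichDecisive [Nonempty A] (h : IsGoodRule F) {G : Finset V}
    (hG : DichDecisive F G) {w : A → ℕ} {u : V → A → ℕ} (hu : ∀ i ∈ G, u i = w) :
    F u ⊆ univ.filter fun x => ∀ y, w y ≤ w x := by
  set T : Finset A := univ.filter fun x => ∀ y, w y ≤ w x with hT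
  have hmT : ∀ x, x ∈ T ↔ ∀ y, w y ≤ w x := fun x => by simp [hT]
  obtain ⟨t, -, ht⟩ := exists_max_image (univ : Finset A) w univ_nonempty
  have htT : t ∈ T := (hmT t).2 fun y => ht y (mem_univ _)
  refine of_single_changes G (fun v => if v ∈ G then tier ∅ T else u v) u
    (fun j hj => by simp [hj]) (fun v => F v ⊆ T) ?_
    (hG T ⟨t, htT⟩ _ fun i hi => by simp [hi])
  intro v v' i hi _ _ hv' hvv hP
  have hw : v' i = w := by rw [hv', hu i hi]
  have key := h.sp v' v i (fun k hk => (hvv k hk).symm) (fun x => ?_) t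
  · have hup : upperSet (v' i) t = T := by
      ext y
      simp only [upperSet, mem_filter, mem_univ, true_and, hmT, hw]
      exact ⟨fun hy z => (ht z (mem_univ _)).trans hy, fun hy => hy t⟩
    rw [hup, (h.subset_iff v T).1 hP] at key
    exact (h.subset_iff v' T).2 (le_antisymm (prob_le_one _ _) key)
  · have : prob (F v) (upperSet (v' i) x) = 1 := by
      rw [← h.subset_iff]
      intro y hy
      simpa [upperSet, hw] using (hmT y).1 (hP hy) x
    rw [this]
    exact prob_le_one _ _

/-- There are no three weak dictators. -/
lemma card_le_two_of_isWeakDictator (hm : 3 ≤ Fintype.card A) (h : IsGoodRule F) {G : Finset V}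
    (hG : ∀ i ∈ G, IsWeakDictator F i) : G.card ≤ 2 := by
  by_contra hcard
  obtain ⟨i, j, k, hi, hj, hk, hij, hik, hjk⟩ := two_lt_card_iff.1 (not_le.1 hcard)
  obtain ⟨a, b, c, hab, hac, hbc⟩ := Fintype.two_lt_card_iff.1 (show 2 < Fintype.card A by omega)
  let p : (A → ℕ) → V → A → ℕ := fun x v => if v = i then x else if v = j then tier ∅ {b} else
    if v = k then tier ∅ {c} else tier ∅ {a, b, c}
  have hb : ∀ x, b ∈ F (p x) := by
    intro x
    obtain ⟨z, hz, hzt⟩ := hG j hj (p x)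
    obtain rfl : z = b := by
      by_contra hne
      simpa [p, hij.symm, tier, hne] using hzt b
    exact hz
  have hc : ∀ x, c ∈ F (p x) := by
    intro x
    obtain ⟨z, hz, hzt⟩ := hG k hk (p x)
    obtain rfl : z = c := by
      by_contra hne
      simpa [p, hik.symm, hjk.symm, tier, hne] using hzt c
    exact hz
  have ha : a ∈ F (p (tier ∅ {a})) := by
    obtain ⟨z, hz, hzt⟩ := hG i hi (p (tier ∅ {a}))
    obtain rfl : z = a := by
      by_contra hne
      simpa [p, tier, hne] using hzt a
    exact hz
  have e₁ : F (p (tier ∅ {a})) = {a, b, c} := by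
    apply Subset.antisymm
    · intro d hd
      by_contra hd'
      simp only [mem_insert, mem_singleton, not_or] at hd'
      refine h.eff _ a d (fun v => ?_) ⟨i, ?_⟩ hd
      · simp only [p]
        split_ifs <;> simp [tier, hd']
      · simp [p, tier, hd']
    · intro d hd
      simp only [mem_insert, mem_singleton] at hd
      rcases hd with rfl | rfl | rfl
      exacts [ha, hb _, hc _]
  have e₂ : F (p (tier ∅ {a, b})) = {b, c} := by
    apply Subset.antisymm
    · intro d hd
      by_contra hd'
      simp only [mem_insert, mem_singleton, not_or] at hd'
      refine h.eff _ b d (fun v => ?_) ⟨j, ?_⟩ hd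
      · simp only [p]
        split_ifs <;> by_cases had : d = a <;> simp [tier, had, hab, hac, hd']
      · simp [p, hij.symm, tier, hd']
    · intro d hd
      simp only [mem_insert, mem_singleton] at hd
      rcases hd with rfl | rfl
      exacts [hb _, hc _]
  have key := h.dich_single (u := p (tier ∅ {a, b})) (u' := p (tier ∅ {a})) (i := i)
    (T := {a, b}) (by simp [p]) (fun v hv => by simp [p, hv])
  rw [prob_pair _ hab, prob_pair _ hab, e₁, e₂] at key
  simp only [prob_singleton] at key
  rw [card_eq_three.2 ⟨a, b, c, hab, hac, hbc, rfl⟩, card_pair hbc] at key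
  simp [hab, hac] at key
  norm_num at key

/-- The weak dictators form a decisive coalition with one or two members. -/
lemma exists_dichDecisive (hn : 2 ≤ Fintype.card V) (hm : 3 ≤ Fintype.card A)
    (h : IsGoodRule F) : ∃ G : Finset V, DichDecisive F G ∧ G.Nonempty ∧ G.card ≤ 2 ∧
      ∀ i, i ∈ G ↔ IsWeakDictator F i := by
  have : Nonempty V := Fintype.card_pos_iff.1 (by omega)
  obtain ⟨G, hG, hmin⟩ := exists_min_image
    (univ.filter fun G : Finset V => DichDecisive F G) card ⟨univ, by simp [h.dichDecisive_univ]⟩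
  simp only [mem_filter, mem_univ, true_and] at hG hmin
  have hwd : ∀ i ∈ G, IsWeakDictator F i := by
    intro i hi
    refine h.exists_mem_top_of_not_compl hn hm
      (h.not_dichDecisive_compl_singleton hm hG hi fun hd => ?_)
    have := hmin _ hd
    have := card_erase_lt_of_mem hi
    omega
  refine ⟨G, hG, ?_, h.card_le_two_of_isWeakDictator hm hwd,
    fun i => ⟨hwd i, mem_of_isWeakDictator hm hG⟩⟩
  by_contra hno
  rw [not_nonempty_iff_eq_empty] at hno
  exact h.not_dichDecisive_empty hm (hno ▸ hG)

end IsGoodRule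

namespace WeakPref

/-- The weak preference relation represented by a utility function. -/
def ofUtility (w : A → ℕ) : WeakPref A where
  rel x y := w y ≤ w x
  total x y := le_total (w y) (w x)
  trans h1 h2 := h2.trans h1

/-- A utility function that represents a weak preference relation. -/
noncomputable def utility (R : WeakPref A) : A → ℕ :=
  fun x => (univ.filter fun y => R.rel x y).card

lemma utility_le_iff (R : WeakPref A) (x y : A) : R.utility y ≤ R.utility x ↔ R.rel x y := by
  constructor
  · intro hle
    by_contra hxy
    have hyx := (R.total x y).resolve_left hxy
    refine absurd hle (not_le.2 (card_lt_card ?_))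
    rw [ssubset_iff_of_subset]
    · exact ⟨y, by simpa using (R.total y y).elim id id, by simpa using hxy⟩
    · intro z hz
      simp only [mem_filter, mem_univ, true_and] at hz ⊢
      exact R.trans hyx hz
  · intro hxy
    refine card_le_card fun z hz => ?_
    simp only [mem_filter, mem_univ, true_and] at hz ⊢
    exact R.trans hxy hz

lemma ofUtility_utility (R : WeakPref A) : ofUtility R.utility = R := by
  have hrel : (ofUtility R.utility).rel = R.rel := by
    ext x y
    exact R.utility_le_iff x y
  cases R
  simpa [ofUtility] using hrel

lemma setProb_ofUtility (X : Finset A) (w : A → ℕ) (x : A) :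
    setProb X (ofUtility w).rel x = prob X (upperSet w x) := by
  unfold setProb prob
  congr 3
  ext y
  simp only [upperSet, mem_inter, mem_filter, mem_univ, true_and]
  rfl

end WeakPref

open WeakPref in
lemma isGoodRule_ofUtility {f : (V → WeakPref A) → Finset A} (hne : ∀ R, (f R).Nonempty)
    (hsp : WeakSPset f) (heff : ExPostEffSet f) :
    IsGoodRule fun u : V → A → ℕ => f fun v => ofUtility (u v) where
  nonempty u := hne _
  sp u u' i hu hle x := by
    by_contra hlt
    refine hsp (fun v => ofUtility (u v)) (fun v => ofUtility (u' v)) i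
      (fun j hj => by simp [hu j hj]) ⟨fun y => ?_, x, ?_⟩
    · simpa only [setProb_ofUtility] using hle y
    · simpa only [setProb_ofUtility] using not_le.1 hlt
  eff u x y hxy := fun ⟨i, hi⟩ => heff _ y ⟨x, hxy, i, not_le.2 hi⟩

/-- The set of weak dictators of a weakly strategyproof and ex post efficient
even-chance SDS has size one or two and is decisive. -/
theorem weak_dictators_card_and_decisive
    (hm : 3 ≤ Fintype.card A) (hn : 2 ≤ Fintype.card V)
    (f : (V → WeakPref A) → Finset A) (hne : ∀ R, (f R).Nonempty)
    (hsp : WeakSPset f) (heff : ExPostEffSet f) :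
    1 ≤ (Finset.univ.filter
          (fun i : V => ∀ R : V → WeakPref A, (f R ∩ tops (R i).rel).Nonempty)).card ∧
    (Finset.univ.filter
          (fun i : V => ∀ R : V → WeakPref A, (f R ∩ tops (R i).rel).Nonempty)).card ≤ 2 ∧
    Decisive f (Finset.univ.filter
          (fun i : V => ∀ R : V → WeakPref A, (f R ∩ tops (R i).rel).Nonempty)) := by
  have hA : Nonempty A := Fintype.card_pos_iff.1 (by omega)
  have h := isGoodRule_ofUtility hne hsp heff
  obtain ⟨G, hG, hGne, hG2, hGiff⟩ := h.exists_dichDecisive hn hm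
  have hR : ∀ R : V → WeakPref A, (fun v => WeakPref.ofUtility (R v).utility) = R :=
    fun R => funext fun v => (R v).ofUtility_utility
  have hfilter : (Finset.univ.filter
      (fun i : V => ∀ R : V → WeakPref A, (f R ∩ tops (R i).rel).Nonempty)) = G := by
    ext i
    rw [hGiff, mem_filter, and_iff_right (mem_univ i)]
    constructor
    · intro hi u
      obtain ⟨x, hx⟩ := hi fun v => WeakPref.ofUtility (u v)
      simp only [mem_inter, tops, mem_filter, mem_univ, true_and] at hx
      exact ⟨x, hx⟩
    · intro hi R
      obtain ⟨x, hx, hxt⟩ := hi fun v => (R v).utility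
      simp only [hR] at hx
      exact ⟨x, by simpa [tops, hx] using fun y => ((R i).utility_le_iff x y).1 (hxt y)⟩
  rw [hfilter]
  refine ⟨hGne.card_pos, hG2, fun R hRG i hi x hx => ?_⟩
  have key := h.subset_top_of_dichDecisive hG (w := (R i).utility) (u := fun v => (R v).utility)
    fun j hj => by rw [hRG j hj i hi]
  simp only [hR] at key
  have hxt := (mem_filter.1 (key hx)).2
  exact mem_filter.2 ⟨mem_univ x, fun y => ((R i).utility_le_iff x y).1 (hxt y)⟩
end
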